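/- Suppose W is finite. Then Poin(W;t) = Poin(ι(θ);t)·Poin(Fix(θ);t) if and only if m(s,θ(s)) ∈ {1,2} for all s ∈ S, i.e., if and only if s commutes with θ(s) for every s ∈ S. -/

import Mathlib

namespace TwistedIdentitiesPaper

open scoped Classical

variable {B : Type*} {W : Type*} [Group W] {M : CoxeterMatrix B}

/-- The Bruhat order on `W`, defined via the subword property: `u ≤ v` iff every
reduced expression for `v` contains a subword representing `u`. -/
def bruhatLE (cs : CoxeterSystem M W) (u v : W) : Prop :=
  ∀ l : List B, cs.IsReduced l → cs.wordProd l = v →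
    ∃ l' : List B, l'.Sublist l ∧ cs.wordProd l' = u

/-- The strict Bruhat order. -/
def bruhatLT (cs : CoxeterSystem M W) (u v : W) : Prop :=
  bruhatLE cs u v ∧ u ≠ v

/-- The action `w ↦ w ⋅ s̲ᵢ`: `w ⋅ s̲ᵢ = w sᵢ` if `θ(sᵢ) w sᵢ = w`, and
`w ⋅ s̲ᵢ = θ(sᵢ) w sᵢ` otherwise. -/
noncomputable def twistAct (cs : CoxeterSystem M W) (θ : W ≃* W) (w : W) (i : B) : W :=
  if θ (cs.simple i) * w * cs.simple i = w then w * cs.simple i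
  else θ (cs.simple i) * w * cs.simple i

/-- `e ⋅ s̲₁ ⋯ s̲ₖ` for a word `s₁ ⋯ sₖ`. -/
noncomputable def twistProd (cs : CoxeterSystem M W) (θ : W ≃* W) (l : List B) : W :=
  l.foldl (twistAct cs θ) 1

/-- The set of twisted involutions `I(θ) = {w : θ(w) = w⁻¹}`. -/
def twistedInvolutions (θ : W ≃* W) : Set W := {w | θ w = w⁻¹}

/-- The set of twisted identities `ι(θ) = {θ(w⁻¹) w : w ∈ W}`. -/
def twistedIdentities (θ : W ≃* W) : Set W := {w | ∃ v : W, w = θ v⁻¹ * v}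

/-- The rank `ρ(w)` of a twisted involution: the least `k` such that
`w = e ⋅ s̲₁ ⋯ s̲ₖ`. -/
noncomputable def twistRank (cs : CoxeterSystem M W) (θ : W ≃* W) (w : W) : ℕ :=
  sInf {k | ∃ l : List B, l.length = k ∧ twistProd cs θ l = w}

/-- `θ` has the no-odd-flip (NOF) property: for every `s ∈ S` with `θ(s) ≠ s`,
the order of `s θ(s)` is even or infinite. -/
def NOF (cs : CoxeterSystem M W) (θ : W ≃* W) : Prop :=
  ∀ i : B, θ (cs.simple i) ≠ cs.simple i →
    Even (orderOf (cs.simple i * θ (cs.simple i))) ∨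
      orderOf (cs.simple i * θ (cs.simple i)) = 0


/-- The Poincaré series of `W`: the generating function of the Coxeter length. -/
noncomputable def poinW (cs : CoxeterSystem M W) : PowerSeries ℕ :=
  PowerSeries.mk fun n => Nat.card {w : W // cs.length w = n}

/-- The Poincaré series of `ι(θ)`: the generating function of the rank `ρ`. -/
noncomputable def poinIota (cs : CoxeterSystem M W) (θ : W ≃* W) : PowerSeries ℕ :=
  PowerSeries.mk fun n =>
    Nat.card {w : W // w ∈ twistedIdentities θ ∧ twistRank cs θ w = n}

/-- The canonical Coxeter generators of `Fix(θ)`: the longest elements of the finite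
standard parabolic subgroups `W_J` with `J = {s, θ(s)}`, `s ∈ S`. -/
def canonicalGens (cs : CoxeterSystem M W) (θ : W ≃* W) : Set W :=
  {x | ∃ i : B,
    (Subgroup.closure ({cs.simple i, θ (cs.simple i)} : Set W) : Set W).Finite ∧
    x ∈ Subgroup.closure ({cs.simple i, θ (cs.simple i)} : Set W) ∧
    ∀ y ∈ Subgroup.closure ({cs.simple i, θ (cs.simple i)} : Set W),
      cs.length y ≤ cs.length x}

/-- The word length on `Fix(θ)` with respect to its canonical Coxeter generators. -/
noncomputable def fixLength (cs : CoxeterSystem M W) (θ : W ≃* W) (f : W) : ℕ :=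
  sInf {n | ∃ l : List W, l.length = n ∧ (∀ x ∈ l, x ∈ canonicalGens cs θ) ∧ l.prod = f}

/-- The Poincaré series of `Fix(θ)`. -/
noncomputable def poinFix (cs : CoxeterSystem M W) (θ : W ≃* W) : PowerSeries ℕ :=
  PowerSeries.mk fun n => Nat.card {w : W // θ w = w ∧ fixLength cs θ w = n}

/-! ### The reflection cocycle -/

/-- The action of a generator on pairs (reflection, sign). -/
noncomputable def signStep (s : W) (hs : s * s = 1) : Equiv.Perm (W × ZMod 2) :=
  Function.Involutive.toPerm (fun p => (s * p.1 * s, p.2 + if p.1 = s then 1 else 0)) (by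
    intro p
    have h1 : s * (s * p.1 * s) * s = p.1 := by
      simp only [mul_assoc, hs, mul_one]; rw [← mul_assoc, hs, one_mul]
    have h2 : s * p.1 * s = s ↔ p.1 = s := by
      rw [mul_eq_right]
      constructor
      · intro h; exact mul_left_cancel (h.trans hs.symm)
      · rintro h; rw [h, hs]
    ext
    · exact h1
    · simp only [h2, add_assoc, CharTwo.add_self_eq_zero, add_zero])

theorem signStep_apply (s : W) (hs : s * s = 1) (p : W × ZMod 2) :
    signStep s hs p = (s * p.1 * s, p.2 + if p.1 = s then 1 else 0) := rfl

theorem signStep_mul_pow {s t : W} (hs : s * s = 1) (ht : t * t = 1) (n : ℕ) (p : W × ZMod 2) :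
    ((signStep s hs * signStep t ht) ^ n) p =
      ((s * t) ^ n * p.1 * ((s * t) ^ n)⁻¹,
        p.2 + ∑ k ∈ Finset.range (2 * n), if p.1 = ((s * t) ^ k)⁻¹ * t then 1 else 0) := by
  have hs' : s⁻¹ = s := inv_eq_of_mul_eq_one_right hs
  have ht' : t⁻¹ = t := inv_eq_of_mul_eq_one_right ht
  have hconj : ∀ k : ℕ, t * (s * t) ^ k = ((s * t) ^ k)⁻¹ * t := by
    intro k
    induction k with
    | zero => simp
    | succ k ih =>
      rw [pow_succ, ← mul_assoc, ih, mul_inv_rev, mul_inv_rev, hs', ht', ← hs', ← ht']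
      have : (s * t) ^ k * (s * t) = (s * t) * (s * t) ^ k := by rw [← pow_succ, pow_succ']
      rw [hs', ht']
      have h2 : ((s * t) ^ k)⁻¹ * (t * s) = (t * s) * ((s * t) ^ k)⁻¹ := by
        have := congrArg (·⁻¹) this
        simp only [mul_inv_rev, hs', ht'] at this
        simpa [mul_assoc] using this.symm
      calc ((s * t) ^ k)⁻¹ * t * (s * t) = ((s * t) ^ k)⁻¹ * (t * s) * t := by
            simp [mul_assoc]
        _ = _ := by rw [h2]
  induction n with
  | zero => simp
  | succ n ih =>
    rw [pow_succ', Equiv.Perm.mul_apply, ih, Equiv.Perm.mul_apply]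
    set x := s * t with hx
    have e1 : x ^ n * p.1 * (x ^ n)⁻¹ = t ↔ p.1 = (x ^ (2 * n))⁻¹ * t := by
      rw [mul_inv_eq_iff_eq_mul, hconj, two_mul, pow_add, mul_inv_rev, mul_assoc]
      constructor
      · intro h; rw [← h]; simp
      · rintro h; rw [h]; simp
    have e2 : t * (x ^ n * p.1 * (x ^ n)⁻¹) * t = s ↔ p.1 = (x ^ (2 * n + 1))⁻¹ * t := by
      have : t * (x ^ n * p.1 * (x ^ n)⁻¹) * t = s ↔ x ^ n * p.1 * (x ^ n)⁻¹ = t * s * t := by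
        constructor
        · intro h; rw [← h]
          simp only [mul_assoc, ht, mul_one]; rw [← mul_assoc t t, ht, one_mul]
        · intro h; rw [h]
          simp only [mul_assoc, ht, mul_one]; rw [← mul_assoc t t, ht, one_mul]
      rw [this, mul_inv_eq_iff_eq_mul]
      have h3 : t * s * t * x ^ n = x⁻¹ * (x ^ n)⁻¹ * t := by
        rw [mul_assoc, hconj, hx, mul_inv_rev, hs', ht']; simp [mul_assoc]
      rw [h3]
      have h4 : (x ^ (2 * n + 1))⁻¹ = (x ^ n)⁻¹ * (x⁻¹ * (x ^ n)⁻¹) := by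
        rw [two_mul, pow_succ, pow_add]
        have : x ^ n * x ^ n * x = x ^ n * x * x ^ n := by
          rw [mul_assoc, ← pow_succ, pow_succ', ← mul_assoc, ← pow_succ', pow_succ]
        rw [this]; simp [mul_assoc]
      rw [h4]
      constructor
      · intro h; rw [mul_assoc, ← h]; simp
      · rintro h; rw [h]; simp [mul_assoc]
    have e3 : x * x ^ n * p.1 * (x * x ^ n)⁻¹ = s * (t * (x ^ n * p.1 * (x ^ n)⁻¹) * t) * s := by
      rw [mul_inv_rev, hx, mul_inv_rev, hs', ht']; simp [mul_assoc]
    ext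
    · simp only [signStep_apply]
      rw [pow_succ', e3]
    · simp only [signStep_apply, e1, e2]
      rw [show 2 * (n + 1) = 2 * n + 1 + 1 by ring, Finset.sum_range_succ, Finset.sum_range_succ]
      ring

theorem isLiftable_signStep (cs : CoxeterSystem M W) :
    M.IsLiftable fun i => signStep (cs.simple i) (cs.simple_mul_simple_self i) := by
  intro i j
  ext1 p
  rw [signStep_mul_pow, cs.simple_mul_simple_pow]
  have : ∑ k ∈ Finset.range (2 * M i j),
      (if p.1 = ((cs.simple i * cs.simple j) ^ k)⁻¹ * cs.simple j then (1 : ZMod 2) else 0) =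
        0 := by
    rw [two_mul, Finset.sum_range_add]
    simp only [pow_add, cs.simple_mul_simple_pow, one_mul]
    exact CharTwo.add_self_eq_zero _
  rw [this]
  simp

/-- The action of `W` on pairs (reflection, sign). -/
noncomputable def signRep (cs : CoxeterSystem M W) : W →* Equiv.Perm (W × ZMod 2) :=
  cs.lift ⟨_, isLiftable_signStep cs⟩

/-- The reflection cocycle. -/
noncomputable def signCocycle (cs : CoxeterSystem M W) (w t : W) : ZMod 2 :=
  (signRep cs w (t, 0)).2

theorem signRep_simple (cs : CoxeterSystem M W) (i : B) (p : W × ZMod 2) :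
    signRep cs (cs.simple i) p = (cs.simple i * p.1 * cs.simple i,
      p.2 + if p.1 = cs.simple i then 1 else 0) := by
  rw [signRep, cs.lift_apply_simple]; rfl

theorem signRep_apply (cs : CoxeterSystem M W) (w : W) (p : W × ZMod 2) :
    signRep cs w p = (w * p.1 * w⁻¹, p.2 + signCocycle cs w p.1) := by
  unfold signCocycle
  induction w using cs.simple_induction_left generalizing p with
  | one => simp
  | mul_simple_left w i ih =>
    rw [map_mul, Equiv.Perm.mul_apply, Equiv.Perm.mul_apply, ih, ih (p.1, 0), signRep_simple,
      signRep_simple]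
    simp [mul_assoc, add_assoc]

theorem signCocycle_mul (cs : CoxeterSystem M W) (u v t : W) :
    signCocycle cs (u * v) t = signCocycle cs v t + signCocycle cs u (v * t * v⁻¹) := by
  conv_lhs => rw [signCocycle, map_mul, Equiv.Perm.mul_apply, signRep_apply, signRep_apply]
  simp

theorem signCocycle_one (cs : CoxeterSystem M W) (t : W) : signCocycle cs 1 t = 0 := by
  simp [signCocycle]

theorem signCocycle_simple (cs : CoxeterSystem M W) (i : B) (t : W) :
    signCocycle cs (cs.simple i) t = if t = cs.simple i then 1 else 0 := by
  simp [signCocycle, signRep_simple]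

theorem mem_rightInvSeq_of_signCocycle (cs : CoxeterSystem M W) (l : List B) (t : W)
    (h : signCocycle cs (cs.wordProd l) t ≠ 0) : t ∈ cs.rightInvSeq l := by
  induction l with
  | nil => simp [signCocycle_one] at h
  | cons i l ih =>
    rw [cs.wordProd_cons, signCocycle_mul, signCocycle_simple] at h
    simp only [CoxeterSystem.rightInvSeq, List.mem_cons]
    by_cases h1 : cs.wordProd l * t * (cs.wordProd l)⁻¹ = cs.simple i
    · left; rw [← h1]; simp [mul_assoc]
    · right; apply ih; simpa [h1] using h

theorem signCocycle_self (cs : CoxeterSystem M W) {t : W} (ht : cs.IsReflection t) :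
    signCocycle cs t t = 1 := by
  obtain ⟨u, i, rfl⟩ := ht
  have h1 := signCocycle_mul cs u u⁻¹ (u * cs.simple i * u⁻¹)
  rw [mul_inv_cancel, signCocycle_one] at h1
  have e1 : u⁻¹ * (u * cs.simple i * u⁻¹) * u⁻¹⁻¹ = cs.simple i := by simp [mul_assoc]
  rw [e1] at h1
  rw [signCocycle_mul, signCocycle_mul, signCocycle_simple, e1]
  have e2 : cs.simple i * cs.simple i * (cs.simple i)⁻¹ = cs.simple i := by simp
  rw [e2, if_pos rfl]
  linear_combination -h1

theorem length_mul_lt_iff_signCocycle (cs : CoxeterSystem M W) {t : W} (ht : cs.IsReflection t)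
    (w : W) : cs.length (w * t) < cs.length w ↔ signCocycle cs w t = 1 := by
  have key : ∀ w, signCocycle cs w t = 1 → cs.length (w * t) < cs.length w := by
    intro w h
    obtain ⟨l, hl, rfl⟩ := cs.exists_isReduced w
    exact (cs.isRightInversion_of_mem_rightInvSeq hl
      (mem_rightInvSeq_of_signCocycle cs l t (by rw [h]; decide))).2
  refine ⟨fun h => ?_, key w⟩
  by_contra hne
  have h0 : signCocycle cs w t = 0 := by
    generalize signCocycle cs w t = z at hne; revert hne; revert z; decide
  have := key (w * t) (by
    rw [signCocycle_mul, signCocycle_self cs ht, ht.mul_self, one_mul, ht.inv, h0, add_zero])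
  rw [mul_assoc, ht.mul_self, mul_one] at this
  omega

/-- The cocycle rule for inversions. -/
theorem length_mul_mul_lt_iff (cs : CoxeterSystem M W) {t : W} (ht : cs.IsReflection t) (u v : W) :
    cs.length (u * v * t) < cs.length (u * v) ↔
      ¬ (cs.length (v * t) < cs.length v ↔
        cs.length (u * (v * t * v⁻¹)) < cs.length u) := by
  rw [length_mul_lt_iff_signCocycle cs ht, length_mul_lt_iff_signCocycle cs ht,
    length_mul_lt_iff_signCocycle cs (ht.conj v), signCocycle_mul]
  generalize signCocycle cs v t = a
  generalize signCocycle cs u _ = b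
  revert a b; decide

theorem mem_rightInvSeq_of_length_lt (cs : CoxeterSystem M W) {l : List B} {t : W}
    (ht : cs.IsReflection t) (h : cs.length (cs.wordProd l * t) < cs.length (cs.wordProd l)) :
    t ∈ cs.rightInvSeq l := by
  apply mem_rightInvSeq_of_signCocycle
  rw [(length_mul_lt_iff_signCocycle cs ht _).1 h]; decide

/-! ### Generators and standard parabolic subgroups -/

section Parabolic

variable (cs : CoxeterSystem M W)

/-- The set of simple reflections. -/
abbrev gens : Set W := Set.range cs.simple

variable {cs} {s t k w : W} {J : Set W}

theorem isReflection_of_mem_gens (hs : s ∈ gens cs) : cs.IsReflection s := by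
  obtain ⟨i, rfl⟩ := hs; exact cs.isReflection_simple i

theorem gen_mul_self (hs : s ∈ gens cs) : s * s = 1 := by
  obtain ⟨i, rfl⟩ := hs; simp

theorem gen_inv (hs : s ∈ gens cs) : s⁻¹ = s := by
  obtain ⟨i, rfl⟩ := hs; simp

theorem gen_mul_cancel_left (hs : s ∈ gens cs) (w : W) : s * (s * w) = w := by
  rw [← mul_assoc, gen_mul_self hs, one_mul]

theorem gen_mul_cancel_right (hs : s ∈ gens cs) (w : W) : w * s * s = w := by
  rw [mul_assoc, gen_mul_self hs, mul_one]

theorem length_gen (hs : s ∈ gens cs) : cs.length s = 1 := by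
  obtain ⟨i, rfl⟩ := hs; simp

theorem gen_ne_one (hs : s ∈ gens cs) : s ≠ 1 := by
  rintro rfl; simpa using length_gen hs

theorem length_mul_gen (hs : s ∈ gens cs) (w : W) :
    cs.length (w * s) = cs.length w + 1 ∨ cs.length (w * s) + 1 = cs.length w := by
  obtain ⟨i, rfl⟩ := hs; exact cs.length_mul_simple w i

theorem length_gen_mul (hs : s ∈ gens cs) (w : W) :
    cs.length (s * w) = cs.length w + 1 ∨ cs.length (s * w) + 1 = cs.length w := by
  obtain ⟨i, rfl⟩ := hs; exact cs.length_simple_mul w i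

theorem length_mul_gen_of_lt (hs : s ∈ gens cs) (h : cs.length w < cs.length (w * s)) :
    cs.length (w * s) = cs.length w + 1 := by
  have := length_mul_gen hs w; omega

theorem length_gen_mul_of_lt (hs : s ∈ gens cs) (h : cs.length w < cs.length (s * w)) :
    cs.length (s * w) = cs.length w + 1 := by
  have := length_gen_mul hs w; omega

/-- If `w * t` is longer than `w` but `s * w * t` is shorter than `s * w`, then `s * w = w * t`. -/
theorem gen_mul_eq_mul_gen (hs : s ∈ gens cs) (ht : t ∈ gens cs)
    (h2 : cs.length w < cs.length (w * t))
    (h3 : cs.length (s * w * t) < cs.length (s * w)) : s * w = w * t := by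
  have h := (length_mul_mul_lt_iff cs (isReflection_of_mem_gens ht) s w).1 h3
  have h4 : cs.length (s * (w * t * w⁻¹)) < cs.length s := by
    by_contra h5
    exact h (iff_of_false (by omega) h5)
  rw [length_gen hs, Nat.lt_one_iff, cs.length_eq_zero_iff] at h4
  have h5 : w * t * w⁻¹ = s := by
    rw [← gen_inv hs]; exact eq_inv_of_mul_eq_one_right h4
  rw [← h5]; simp

theorem exists_isReduced_of_mem_closure (hJ : J ⊆ gens cs) {h : W}
    (hh : h ∈ Subgroup.closure J) :
    ∃ l : List B, cs.IsReduced l ∧ (∀ i ∈ l, cs.simple i ∈ J) ∧ cs.wordProd l = h := by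
  have step : ∀ (l : List B) (s : W), cs.IsReduced l → (∀ i ∈ l, cs.simple i ∈ J) → s ∈ J →
      ∃ l' : List B, cs.IsReduced l' ∧ (∀ i ∈ l', cs.simple i ∈ J) ∧
        cs.wordProd l' = cs.wordProd l * s := by
    intro l s hl hlJ hs
    obtain ⟨i, rfl⟩ := hJ hs
    rcases cs.length_mul_simple (cs.wordProd l) i with h | h
    · refine ⟨l ++ [i], ?_, ?_, by simp [cs.wordProd_append]⟩
      · simp only [CoxeterSystem.IsReduced, cs.wordProd_append, cs.wordProd_singleton, h, hl.eq,
          List.length_append, List.length_singleton]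
      · intro j hj
        rw [List.mem_append, List.mem_singleton] at hj
        rcases hj with hj | rfl
        exacts [hlJ j hj, hs]
    · have hm := mem_rightInvSeq_of_length_lt cs (cs.isReflection_simple i) (l := l) (by omega)
      obtain ⟨j, hj, hj'⟩ := List.getElem_of_mem hm
      have he := cs.wordProd_mul_getD_rightInvSeq l j
      rw [List.getD_eq_getElem _ _ hj, hj'] at he
      rw [CoxeterSystem.length_rightInvSeq] at hj
      refine ⟨l.eraseIdx j, ?_, fun m hm => hlJ m (List.mem_of_mem_eraseIdx hm), he.symm⟩
      rw [CoxeterSystem.IsReduced, ← he]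
      have := List.length_eraseIdx_of_lt hj
      have := hl.eq
      omega
  induction hh using Subgroup.closure_induction_right with
  | one => exact ⟨[], by simp [CoxeterSystem.IsReduced], by simp, by simp⟩
  | mul_right x hx y hy ih =>
    obtain ⟨l, hl, hlJ, rfl⟩ := ih
    exact step l y hl hlJ hy
  | mul_inv_cancel x hx y hy ih =>
    obtain ⟨l, hl, hlJ, rfl⟩ := ih
    rw [gen_inv (hJ hy)]
    exact step l y hl hlJ hy

theorem exists_right_descent_of_mem_closure (hJ : J ⊆ gens cs) {h : W}
    (hh : h ∈ Subgroup.closure J) (h1 : h ≠ 1) :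
    ∃ k ∈ J, ∃ h' ∈ Subgroup.closure J, h = h' * k ∧ cs.length h = cs.length h' + 1 := by
  obtain ⟨l, hl, hlJ, rfl⟩ := exists_isReduced_of_mem_closure hJ hh
  rcases List.eq_nil_or_concat l with rfl | ⟨l', i, rfl⟩
  · simp at h1
  · rw [cs.wordProd_concat] at *
    have hi : cs.simple i ∈ J := hlJ i (by simp)
    refine ⟨cs.simple i, hi, cs.wordProd l', ?_, rfl, ?_⟩
    · have := mul_mem hh (Subgroup.subset_closure hi)
      simpa using this
    · have h2 := hl.eq
      have h3 := cs.length_wordProd_le l'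
      have h4 := cs.length_mul_simple (cs.wordProd l') i
      rw [cs.wordProd_concat] at h2
      simp only [List.concat_eq_append, List.length_append, List.length_singleton] at h2
      omega

theorem exists_left_descent_of_mem_closure (hJ : J ⊆ gens cs) {h : W}
    (hh : h ∈ Subgroup.closure J) (h1 : h ≠ 1) :
    ∃ k ∈ J, ∃ h' ∈ Subgroup.closure J, h = k * h' ∧ cs.length h = cs.length h' + 1 := by
  obtain ⟨k, hk, h', hh', he, hl⟩ :=
    exists_right_descent_of_mem_closure hJ (inv_mem hh) (inv_ne_one.2 h1)
  refine ⟨k, hk, h'⁻¹, inv_mem hh', ?_, ?_⟩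
  · rw [← inv_inv h, he, mul_inv_rev, gen_inv (hJ hk)]
  · rw [← cs.length_inv h, hl, cs.length_inv]

theorem closure_induction_length_right (hJ : J ⊆ gens cs) {P : W → Prop} (one : P 1)
    (mul : ∀ h ∈ Subgroup.closure J, ∀ k ∈ J, cs.length (h * k) = cs.length h + 1 → P h → P (h * k))
    {h : W} (hh : h ∈ Subgroup.closure J) : P h := by
  induction hn : cs.length h generalizing h with
  | zero => rw [cs.length_eq_zero_iff] at hn; rwa [hn]
  | succ n ih =>
    have h1 : h ≠ 1 := by rintro rfl; simp at hn
    obtain ⟨k, hk, h', hh', rfl, hl⟩ := exists_right_descent_of_mem_closure hJ hh h1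
    exact mul h' hh' k hk hl (ih hh' (by omega))

theorem mem_of_gen_mem_closure (hJ : J ⊆ gens cs) (hs : s ∈ gens cs)
    (h : s ∈ Subgroup.closure J) : s ∈ J := by
  obtain ⟨k, hk, h', hh', rfl, hl⟩ :=
    exists_right_descent_of_mem_closure hJ h (gen_ne_one hs)
  rw [length_gen hs] at hl
  have : h' = 1 := by rw [← cs.length_eq_zero_iff]; omega
  rw [this, one_mul]; exact hk

theorem rightInvSeq_subset_closure {l : List B} (hl : ∀ i ∈ l, cs.simple i ∈ J) :
    ∀ t ∈ cs.rightInvSeq l, t ∈ Subgroup.closure J := by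
  have hw : ∀ l : List B, (∀ i ∈ l, cs.simple i ∈ J) → cs.wordProd l ∈ Subgroup.closure J := by
    intro l hl
    refine list_prod_mem fun x hx => ?_
    obtain ⟨i, hi, rfl⟩ := List.mem_map.1 hx
    exact Subgroup.subset_closure (hl i hi)
  induction l with
  | nil => simp
  | cons i l ih =>
    intro t ht
    simp only [CoxeterSystem.rightInvSeq, List.mem_cons] at ht
    have hl' : ∀ j ∈ l, cs.simple j ∈ J := fun j hj => hl j (List.mem_cons_of_mem _ hj)
    rcases ht with rfl | ht
    · exact mul_mem (mul_mem (inv_mem (hw l hl'))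
        (Subgroup.subset_closure (hl i List.mem_cons_self))) (hw l hl')
    · exact ih hl' t ht

theorem reflection_mem_closure (hJ : J ⊆ gens cs) {h t : W} (hh : h ∈ Subgroup.closure J)
    (ht : cs.IsReflection t) (hlt : cs.length (h * t) < cs.length h) :
    t ∈ Subgroup.closure J := by
  obtain ⟨l, -, hlJ, rfl⟩ := exists_isReduced_of_mem_closure hJ hh
  exact rightInvSeq_subset_closure hlJ t (mem_rightInvSeq_of_length_lt cs ht hlt)

theorem length_mul_of_forall_reflection (hJ : J ⊆ gens cs) {z : W}
    (hz : ∀ t ∈ Subgroup.closure J, cs.length z ≤ cs.length (z * t)) {h : W}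
    (hh : h ∈ Subgroup.closure J) : cs.length (z * h) = cs.length z + cs.length h := by
  refine closure_induction_length_right hJ
    (P := fun h => cs.length (z * h) = cs.length z + cs.length h) (by simp) ?_ hh
  · intro h hh k hk hl ih
    rw [hl, ← add_assoc, ← ih, ← mul_assoc]
    apply length_mul_gen_of_lt (hJ hk)
    by_contra hlt
    have h1 : cs.length (z * h * k) < cs.length (z * h) := by
      have := length_mul_gen (hJ hk) (z * h); omega
    rw [length_mul_mul_lt_iff cs (isReflection_of_mem_gens (hJ hk))] at h1
    have := hz (h * k * h⁻¹)
      (mul_mem (mul_mem hh (Subgroup.subset_closure hk)) (inv_mem hh))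
    apply h1
    exact iff_of_false (by omega) (by omega)

theorem exists_coset_rep (J : Set W) (w : W) :
    ∃ z, ∃ h ∈ Subgroup.closure J, w = z * h ∧
      ∀ t ∈ Subgroup.closure J, cs.length z ≤ cs.length (z * t) := by
  have hne : {z | ∃ h ∈ Subgroup.closure J, w = z * h}.Nonempty := ⟨w, 1, one_mem _, by simp⟩
  set z := Function.argminOn cs.length _ hne with hz
  obtain ⟨h, hh, hw⟩ : z ∈ {z | ∃ h ∈ Subgroup.closure J, w = z * h} :=
    Function.argminOn_mem _ _ _
  refine ⟨z, h, hh, hw, fun t ht => ?_⟩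
  apply Function.argminOn_le
  exact ⟨t⁻¹ * h, mul_mem (inv_mem ht) hh, by rw [hw]; simp [mul_assoc]⟩

/-- Lengths add for minimal coset representatives. -/
theorem length_mul_of_ascents (hJ : J ⊆ gens cs) {z : W}
    (hz : ∀ k ∈ J, cs.length z < cs.length (z * k)) {h : W}
    (hh : h ∈ Subgroup.closure J) : cs.length (z * h) = cs.length z + cs.length h := by
  obtain ⟨z', g, hg, rfl, hz'⟩ := exists_coset_rep (cs := cs) J z
  have hg1 : g = 1 := by
    by_contra hne
    obtain ⟨k, hk, g', hg', rfl, hl⟩ := exists_right_descent_of_mem_closure hJ hg hne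
    have h1 := length_mul_of_forall_reflection hJ hz' hg
    have h2 := length_mul_of_forall_reflection hJ hz' hg'
    have h3 := hz k hk
    rw [← mul_assoc] at h1
    rw [← mul_assoc, gen_mul_cancel_right (hJ hk)] at h3
    omega
  rw [hg1, mul_one]
  exact length_mul_of_forall_reflection hJ hz' hh

/-- The version of `length_mul_of_ascents` for left multiplication. -/
theorem length_mul_of_left_ascents (hJ : J ⊆ gens cs) {z : W}
    (hz : ∀ k ∈ J, cs.length z < cs.length (k * z)) {h : W}
    (hh : h ∈ Subgroup.closure J) : cs.length (h * z) = cs.length h + cs.length z := by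
  rw [← cs.length_inv, mul_inv_rev, length_mul_of_ascents hJ _ (inv_mem hh), cs.length_inv,
    cs.length_inv, add_comm]
  intro k hk
  rw [cs.length_inv, ← cs.length_inv (z⁻¹ * k), mul_inv_rev, inv_inv, gen_inv (hJ hk)]
  exact hz k hk

end Parabolic

/-! ### The action of the Hecke algebra on functions -/

section Hecke

variable (cs : CoxeterSystem M W) {A : Type*} [CommRing A] (q : A)

/-- The action of the Hecke generator attached to `s` on functions on `W`, from the right. -/
noncomputable def heckeR (s : W) : (W → A) →ₗ[A] (W → A) where
  toFun f w := if cs.length w < cs.length (w * s) then f (w * s) else q * f (w * s) + (q - 1) * f w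
  map_add' f g := by
    ext w; simp only [Pi.add_apply]; split_ifs <;> ring
  map_smul' c f := by
    ext w; simp only [Pi.smul_apply, smul_eq_mul, RingHom.id_apply]; split_ifs <;> ring

/-- The action of the Hecke generator attached to `s` on functions on `W`, from the left. -/
noncomputable def heckeL (s : W) (f : W → A) (w : W) : A :=
  if cs.length w < cs.length (s * w) then f (s * w) else q * f (s * w) + (q - 1) * f w

/-- The right action of a word. -/
noncomputable def heckeWord (l : List B) (f : W → A) : W → A :=
  l.foldl (fun f i => heckeR cs q (cs.simple i) f) f

/-- The right action of the basis element attached to `v`. -/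
noncomputable def heckeBasis (v : W) (f : W → A) : W → A :=
  heckeWord cs q (cs.exists_isReduced v).choose f

variable {cs q} {s t w v p : W} (f : W → A)

theorem heckeR_apply (s : W) (f : W → A) (w : W) : heckeR cs q s f w =
    if cs.length w < cs.length (w * s) then f (w * s) else q * f (w * s) + (q - 1) * f w := rfl

theorem heckeR_of_lt (h : cs.length w < cs.length (w * s)) : heckeR cs q s f w = f (w * s) := by
  rw [heckeR_apply, if_pos h]

theorem heckeR_of_le (h : cs.length (w * s) ≤ cs.length w) :
    heckeR cs q s f w = q * f (w * s) + (q - 1) * f w := by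
  rw [heckeR_apply, if_neg (by omega)]

theorem heckeL_of_lt (h : cs.length w < cs.length (s * w)) : heckeL cs q s f w = f (s * w) := by
  rw [heckeL, if_pos h]

theorem heckeR_heckeR (hs : s ∈ gens cs) :
    heckeR cs q s (heckeR cs q s f) = q • f + (q - 1) • heckeR cs q s f := by
  ext w
  simp only [Pi.add_apply, Pi.smul_apply, smul_eq_mul]
  rcases length_mul_gen hs w with h | h
  · rw [heckeR_of_lt _ (by omega), heckeR_of_le _ (by rw [gen_mul_cancel_right hs]; omega),
      gen_mul_cancel_right hs, heckeR_of_lt _ (by omega)]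
  · rw [heckeR_of_le _ (by omega), heckeR_of_lt _ (by rw [gen_mul_cancel_right hs]; omega),
      gen_mul_cancel_right hs]

theorem heckeL_heckeR_comm (hs : s ∈ gens cs) (ht : t ∈ gens cs) :
    heckeL cs q s (heckeR cs q t f) = heckeR cs q t (heckeL cs q s f) := by
  ext w
  have a1 := length_gen_mul hs w
  have a2 := length_mul_gen ht w
  have a3 := length_gen_mul hs (w * t)
  have a4 := length_mul_gen ht (s * w)
  rw [← mul_assoc] at a3
  have key1 : cs.length w < cs.length (s * w) → cs.length w < cs.length (w * t) →
      cs.length (s * w * t) < cs.length (s * w) → s * w = w * t :=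
    fun _ h2 h3 => gen_mul_eq_mul_gen hs ht h2 h3
  have key2 : cs.length (s * w) < cs.length w → cs.length (w * t) < cs.length w →
      cs.length (s * w) < cs.length (s * w * t) → s * w = w * t := by
    intro h1 h2 h3
    have h4 := gen_mul_eq_mul_gen (w := s * w) hs ht h3 (by rwa [gen_mul_cancel_left hs])
    rw [gen_mul_cancel_left hs] at h4
    conv_rhs => rw [h4, gen_mul_cancel_right ht]
  have key : s * w = w * t → s * w * t = w := fun h => by rw [h, gen_mul_cancel_right ht]
  simp only [heckeL, heckeR_apply, ← mul_assoc] at *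
  by_cases c1 : cs.length w < cs.length (s * w) <;>
  by_cases c2 : cs.length w < cs.length (w * t) <;>
  by_cases c3 : cs.length (s * w) < cs.length (s * w * t) <;>
  by_cases c4 : cs.length (w * t) < cs.length (s * w * t) <;>
  simp only [c1, c2, c3, c4, if_true, if_false] <;> first
    | omega
    | ring1
    | (have e := key1 (by omega) (by omega) (by omega); rw [key e]; simp only [e]; try ring1)
    | (have e := key2 (by omega) (by omega) (by omega); rw [key e]; simp only [e]; try ring1)

theorem heckeWord_nil : heckeWord cs q [] f = f := rfl

theorem heckeWord_append (l l' : List B) :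
    heckeWord cs q (l ++ l') f = heckeWord cs q l' (heckeWord cs q l f) := by
  rw [heckeWord, List.foldl_append]; rfl

theorem heckeWord_concat (l : List B) (i : B) :
    heckeWord cs q (l ++ [i]) f = heckeR cs q (cs.simple i) (heckeWord cs q l f) := by
  rw [heckeWord_append]; rfl

theorem heckeL_heckeWord (i : B) (l : List B) :
    heckeL cs q (cs.simple i) (heckeWord cs q l f) =
      heckeWord cs q l (heckeL cs q (cs.simple i) f) := by
  induction l using List.reverseRecOn with
  | nil => rfl
  | append_singleton l j ih =>
    rw [heckeWord_concat, heckeWord_concat, ← ih,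
      heckeL_heckeR_comm _ (Set.mem_range_self i) (Set.mem_range_self j)]

theorem isReduced_of_append_left {l l' : List B} (h : cs.IsReduced (l ++ l')) :
    cs.IsReduced l := by
  simpa using h.take l.length

theorem isReduced_of_append_right {l l' : List B} (h : cs.IsReduced (l ++ l')) :
    cs.IsReduced l' := by
  simpa using h.drop l.length

theorem heckeWord_apply_one {l : List B} (hl : cs.IsReduced l) (w : W)
    (h : cs.length (w * (cs.wordProd l)⁻¹) = cs.length w + l.length) :
    heckeWord cs q l f w = f (w * (cs.wordProd l)⁻¹) := by
  induction l using List.reverseRecOn generalizing w with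
  | nil => simp [heckeWord_nil]
  | append_singleton l i ih =>
    have hl' := isReduced_of_append_left hl
    have e : w * (cs.wordProd (l ++ [i]))⁻¹ = w * cs.simple i * (cs.wordProd l)⁻¹ := by
      simp [cs.wordProd_append, mul_assoc]
    rw [e] at h ⊢
    have h1 := cs.length_mul_le (w * cs.simple i) (cs.wordProd l)⁻¹
    rw [cs.length_inv, hl'.eq] at h1
    rw [List.length_append, List.length_singleton] at h
    have h2 := cs.length_mul_simple w i
    rw [heckeWord_concat, heckeR_of_lt _ (by omega), ih hl' _ (by omega)]

theorem heckeWord_eq_of_wordProd_eq {l l' : List B} (hl : cs.IsReduced l) (hl' : cs.IsReduced l')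
    (h : cs.wordProd l = cs.wordProd l') : heckeWord cs q l f = heckeWord cs q l' f := by
  ext w
  obtain ⟨m, hm, rfl⟩ := cs.exists_isReduced w
  induction m generalizing f with
  | nil =>
    rw [cs.wordProd_nil, heckeWord_apply_one _ hl _ (by rw [one_mul, cs.length_inv, hl.eq]; simp),
      heckeWord_apply_one _ hl' _ (by rw [one_mul, cs.length_inv, hl'.eq]; simp), h]
  | cons i m ih =>
    have hm' : cs.IsReduced m := isReduced_of_append_right (l := [i]) hm
    have hlt : cs.length (cs.wordProd m) < cs.length (cs.simple i * cs.wordProd m) := by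
      rw [← cs.wordProd_cons, hm.eq, hm'.eq]; simp
    rw [cs.wordProd_cons, ← heckeL_of_lt (q := q) (heckeWord cs q l f) hlt,
      ← heckeL_of_lt (q := q) (heckeWord cs q l' f) hlt, heckeL_heckeWord, heckeL_heckeWord,
      ih _ hm']

theorem heckeBasis_wordProd {l : List B} (hl : cs.IsReduced l) :
    heckeBasis cs q (cs.wordProd l) f = heckeWord cs q l f := by
  have h := (cs.exists_isReduced (cs.wordProd l)).choose_spec
  exact heckeWord_eq_of_wordProd_eq f h.1 hl h.2.symm

theorem heckeBasis_one : heckeBasis cs q 1 f = f := by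
  rw [← cs.wordProd_nil, heckeBasis_wordProd _ (by simp [CoxeterSystem.IsReduced]), heckeWord_nil]

theorem heckeBasis_mul (h : cs.length (v * p) = cs.length v + cs.length p) :
    heckeBasis cs q (v * p) f = heckeBasis cs q p (heckeBasis cs q v f) := by
  obtain ⟨l, hl, rfl⟩ := cs.exists_isReduced v
  obtain ⟨l', hl', rfl⟩ := cs.exists_isReduced p
  rw [hl.eq, hl'.eq, ← cs.wordProd_append, ← List.length_append] at h
  rw [← cs.wordProd_append, heckeBasis_wordProd _ h, heckeWord_append, heckeBasis_wordProd _ hl,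
    heckeBasis_wordProd _ hl']

theorem heckeBasis_gen (hs : s ∈ gens cs) : heckeBasis cs q s f = heckeR cs q s f := by
  obtain ⟨i, rfl⟩ := hs
  rw [← cs.wordProd_singleton, heckeBasis_wordProd _ (by simp [CoxeterSystem.IsReduced])]
  simp [heckeWord]

theorem heckeBasis_mul_gen (hs : s ∈ gens cs) (h : cs.length v < cs.length (v * s)) :
    heckeBasis cs q (v * s) f = heckeR cs q s (heckeBasis cs q v f) := by
  rw [heckeBasis_mul _ (by rw [length_gen hs, length_mul_gen_of_lt hs h]), heckeBasis_gen _ hs]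

theorem heckeBasis_gen_mul (hs : s ∈ gens cs) (h : cs.length v < cs.length (s * v)) :
    heckeBasis cs q (s * v) f = heckeBasis cs q v (heckeR cs q s f) := by
  rw [heckeBasis_mul _ (by rw [length_gen hs, length_gen_mul_of_lt hs h, add_comm]),
    heckeBasis_gen _ hs]

theorem heckeBasis_apply_one (v : W) : heckeBasis cs q v f 1 = f v⁻¹ := by
  obtain ⟨l, hl, rfl⟩ := cs.exists_isReduced v
  rw [heckeBasis_wordProd _ hl, heckeWord_apply_one _ hl, one_mul]
  rw [one_mul, cs.length_inv, hl.eq, cs.length_one, zero_add]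

theorem heckeBasis_smul (c : A) (v : W) :
    heckeBasis cs q v (c • f) = c • heckeBasis cs q v f := by
  obtain ⟨l, hl, rfl⟩ := cs.exists_isReduced v
  rw [heckeBasis_wordProd _ hl, heckeBasis_wordProd _ hl]
  clear hl
  induction l using List.reverseRecOn with
  | nil => rfl
  | append_singleton l i ih => rw [heckeWord_concat, heckeWord_concat, ih, map_smul]

theorem sum_heckeR [Fintype W] (hs : s ∈ gens cs) :
    ∑ w, heckeR cs q s f w = q * ∑ w, f w := by
  have h1 : ∀ w, heckeR cs q s f w =
      (if cs.length w < cs.length (w * s) then f (w * s) else q * f (w * s)) +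
      if cs.length w < cs.length (w * s) then 0 else (q - 1) * f w := by
    intro w; rw [heckeR_apply]; split_ifs <;> ring
  simp only [h1, Finset.sum_add_distrib]
  rw [← Equiv.sum_comp (Equiv.mulRight s), ← Finset.sum_add_distrib, Finset.mul_sum]
  refine Finset.sum_congr rfl fun w _ => ?_
  simp only [Equiv.coe_mulRight, gen_mul_cancel_right hs]
  rcases length_mul_gen hs w with h | h
  · rw [if_neg (by omega), if_pos (by omega), add_zero]
  · rw [if_pos (by omega), if_neg (by omega)]; ring

theorem sum_heckeBasis [Fintype W] (v : W) :
    ∑ w, heckeBasis cs q v f w = q ^ cs.length v * ∑ w, f w := by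
  obtain ⟨l, hl, rfl⟩ := cs.exists_isReduced v
  rw [heckeBasis_wordProd _ hl, hl.eq]
  clear hl
  induction l using List.reverseRecOn with
  | nil => simp [heckeWord_nil]
  | append_singleton l i ih =>
    rw [heckeWord_concat, sum_heckeR _ (Set.mem_range_self i), ih, List.length_append,
      List.length_singleton, pow_succ]
    ring

end Hecke

/-! ### Twisted identities -/

/-- `θ` is an involutive automorphism permuting the simple reflections. -/
structure IsDiagramInvolution (cs : CoxeterSystem M W) (θ : W ≃* W) : Prop where
  involutive : Function.Involutive θ
  map_gens : ∀ s ∈ gens cs, θ s ∈ gens cs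

/-- The twisted identity attached to `v`. -/
def twistElt (θ : W ≃* W) (v : W) : W := θ v⁻¹ * v

/-- `v` is a shortest element giving its twisted identity. -/
def IsGood (cs : CoxeterSystem M W) (θ : W ≃* W) (v : W) : Prop :=
  cs.length (twistElt θ v) = 2 * cs.length v

section Twist

variable {cs : CoxeterSystem M W} {θ : W ≃* W} {s t u v x y z p : W} {J : Set W}

theorem twistElt_mem (v : W) : twistElt θ v ∈ twistedIdentities θ := ⟨v, rfl⟩

theorem twistElt_one : twistElt θ 1 = 1 := by simp [twistElt]

theorem twistElt_mul (u p : W) : twistElt θ (u * p) = θ p⁻¹ * twistElt θ u * p := by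
  simp [twistElt, mul_assoc]

theorem twistElt_mul_gen (hs : s ∈ gens cs) (u : W) :
    twistElt θ (u * s) = θ s * twistElt θ u * s := by
  rw [twistElt_mul, gen_inv hs]

theorem twist_mem (hx : x ∈ twistedIdentities θ) (p : W) :
    θ p⁻¹ * x * p ∈ twistedIdentities θ := by
  obtain ⟨v, rfl⟩ := hx
  exact ⟨v * p, by simp [mul_assoc]⟩

theorem twist_gen_mem (hx : x ∈ twistedIdentities θ) (hs : s ∈ gens cs) :
    θ s * x * s ∈ twistedIdentities θ := by
  have := twist_mem hx s
  rwa [gen_inv hs] at this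

namespace IsDiagramInvolution

variable (hθ : IsDiagramInvolution cs θ)
include hθ

theorem apply_apply (w : W) : θ (θ w) = w := hθ.involutive w

theorem length_map (w : W) : cs.length (θ w) = cs.length w := by
  have key : ∀ w, cs.length (θ w) ≤ cs.length w := by
    intro w
    obtain ⟨l, hl, rfl⟩ := cs.exists_isReduced w
    rw [hl.eq]
    clear hl
    induction l with
    | nil => simp
    | cons i l ih =>
      rw [cs.wordProd_cons, map_mul]
      have h1 := cs.length_mul_le (θ (cs.simple i)) (θ (cs.wordProd l))
      rw [length_gen (hθ.map_gens _ ⟨i, rfl⟩)] at h1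
      simp only [List.length_cons]; omega
  refine le_antisymm (key w) ?_
  conv_lhs => rw [← hθ.apply_apply w]
  exact key _

theorem map_eq_inv (hx : x ∈ twistedIdentities θ) : θ x = x⁻¹ := by
  obtain ⟨v, rfl⟩ := hx
  simp [hθ.apply_apply]

theorem length_map_gen_mul (hx : x ∈ twistedIdentities θ) (hs : s ∈ gens cs) :
    cs.length (θ s * x) = cs.length (x * s) := by
  rw [← hθ.length_map (x * s), ← cs.length_inv (θ (x * s)), map_mul, hθ.map_eq_inv hx,
    mul_inv_rev, inv_inv, gen_inv (hθ.map_gens _ hs)]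

theorem map_mul_eq_symm (hx : x ∈ twistedIdentities θ) (h : θ t * x = x * s) :
    θ s * x = x * t := by
  have := congrArg θ h
  rw [map_mul, map_mul, hθ.map_eq_inv hx, hθ.apply_apply] at this
  have h2 : x * t = x * (t * x⁻¹) * x := by simp [mul_assoc]
  rw [h2, this]; simp

/-- A fixed point of twisted conjugation by `s` cannot have `s` as a descent. -/
theorem lt_of_stuck (hx : x ∈ twistedIdentities θ) (hs : s ∈ gens cs) (h : θ s * x = x * s) :
    cs.length x < cs.length (x * s) := by
  obtain ⟨v, rfl⟩ := hx
  have hrs := isReflection_of_mem_gens hs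
  have ht : θ (v * s * v⁻¹) = v * s * v⁻¹ := by
    have h1 : θ v * (θ s * (θ v⁻¹ * v)) * v⁻¹ = θ v * (θ v⁻¹ * v * s) * v⁻¹ := by rw [h]
    simpa [mul_assoc] using h1
  by_contra hlt
  have h2 : cs.length (θ v⁻¹ * v * s) < cs.length (θ v⁻¹ * v) := by
    have := length_mul_gen hs (θ v⁻¹ * v); omega
  rw [length_mul_mul_lt_iff cs hrs] at h2
  apply h2
  have e1 : cs.length (θ v⁻¹ * (v * s * v⁻¹)) = cs.length (v * s) := by
    rw [← ht, ← map_mul, hθ.length_map, ← cs.length_inv]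
    simp [gen_inv hs, mul_assoc]
  rw [e1, hθ.length_map, cs.length_inv]

theorem length_twist_of_descent (hx : x ∈ twistedIdentities θ) (hs : s ∈ gens cs)
    (h : cs.length (x * s) < cs.length x) : cs.length (θ s * x * s) + 2 = cs.length x := by
  have h1 := length_mul_gen hs x
  have h2 := length_gen_mul (hθ.map_gens _ hs) (x * s)
  rw [← mul_assoc] at h2
  by_contra hne
  have h3 := gen_mul_eq_mul_gen (w := x * s) (hθ.map_gens _ hs) hs
    (by rwa [gen_mul_cancel_right hs])
    (by rw [← mul_assoc, gen_mul_cancel_right hs, hθ.length_map_gen_mul hx hs]; omega)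
  rw [gen_mul_cancel_right hs, ← mul_assoc] at h3
  have h4 : θ s * x = x * s := by rw [← gen_mul_cancel_right hs (θ s * x), h3]
  have := hθ.lt_of_stuck hx hs h4
  omega

theorem length_twist_of_ascent (hx : x ∈ twistedIdentities θ) (hs : s ∈ gens cs)
    (h : cs.length x < cs.length (x * s)) (hne : θ s * x ≠ x * s) :
    cs.length (θ s * x * s) = cs.length x + 2 := by
  have h1 := hθ.length_map_gen_mul hx hs
  have h2 := length_mul_gen hs x
  have h3 := length_mul_gen hs (θ s * x)
  by_contra h4
  exact hne (gen_mul_eq_mul_gen (hθ.map_gens _ hs) hs h (by omega))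

theorem length_twist_le (x p : W) :
    cs.length (θ p⁻¹ * x * p) ≤ cs.length x + 2 * cs.length p := by
  have h1 := cs.length_mul_le (θ p⁻¹ * x) p
  have h2 := cs.length_mul_le (θ p⁻¹) x
  rw [hθ.length_map, cs.length_inv] at h2
  omega

theorem isGood_mul (hu : IsGood cs θ u)
    (h : cs.length (twistElt θ (u * p)) = cs.length (twistElt θ u) + 2 * cs.length p) :
    IsGood cs θ (u * p) ∧ cs.length (u * p) = cs.length u + cs.length p := by
  have h1 := hθ.length_twist_le 1 (u * p)
  rw [mul_one, cs.length_one, zero_add] at h1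
  have h2 := cs.length_mul_le u p
  change cs.length (twistElt θ (u * p)) ≤ _ at h1
  unfold IsGood at *
  omega

theorem isGood_of_mul_gen (hs : s ∈ gens cs) (hu : IsGood cs θ (u * s))
    (h : cs.length u < cs.length (u * s)) : IsGood cs θ u := by
  have h1 := hθ.length_twist_le 1 u
  rw [mul_one, cs.length_one, zero_add] at h1
  change cs.length (twistElt θ u) ≤ _ at h1
  have h2 := hθ.length_twist_le (twistElt θ u) s
  rw [← twistElt_mul, length_gen hs] at h2
  unfold IsGood at *
  have := length_mul_gen_of_lt hs h
  omega

theorem isGood_mul_gen (hs : s ∈ gens cs) (hu : IsGood cs θ u)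
    (h : cs.length (θ s * twistElt θ u * s) = cs.length (twistElt θ u) + 2) :
    IsGood cs θ (u * s) ∧ cs.length (u * s) = cs.length u + 1 := by
  rw [← twistElt_mul_gen hs] at h
  have := hθ.isGood_mul (p := s) hu (by rw [h, length_gen hs])
  rwa [length_gen hs] at this

theorem exists_isGood (hx : x ∈ twistedIdentities θ) : ∃ v, IsGood cs θ v ∧ twistElt θ v = x := by
  induction hn : cs.length x using Nat.strong_induction_on generalizing x with
  | _ n ih =>
    by_cases h1 : x = 1
    · exact ⟨1, by simp [IsGood, twistElt], by rw [h1, twistElt_one]⟩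
    · obtain ⟨i, hi⟩ := cs.exists_rightDescent_of_ne_one h1
      have hs : cs.simple i ∈ gens cs := ⟨i, rfl⟩
      have hd := hθ.length_twist_of_descent hx hs hi
      obtain ⟨v, hv, hvx⟩ := ih _ (by omega) (twist_gen_mem hx hs) rfl
      have e : θ (cs.simple i) * twistElt θ v * cs.simple i = x := by
        rw [hvx, mul_assoc, gen_mul_cancel_right hs, ← mul_assoc, ← map_mul]
        simp
      refine ⟨v * cs.simple i, (hθ.isGood_mul_gen hs hv ?_).1, ?_⟩
      · rw [e, hvx]; omega
      · rw [twistElt_mul_gen hs, e]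

theorem exists_descent (hJ : J ⊆ gens cs) (hx : x ∈ twistedIdentities θ) :
    ∃ z ∈ twistedIdentities θ, (∀ k ∈ J, cs.length z < cs.length (z * k)) ∧
      ∃ p ∈ Subgroup.closure J, x = θ p⁻¹ * z * p ∧
        cs.length x = cs.length z + 2 * cs.length p := by
  induction hn : cs.length x using Nat.strong_induction_on generalizing x with
  | _ n ih =>
    by_cases h1 : ∀ k ∈ J, cs.length x < cs.length (x * k)
    · exact ⟨x, hx, h1, 1, one_mem _, by simp, by simp [hn]⟩
    · push Not at h1
      obtain ⟨k, hk, hle⟩ := h1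
      have hs := hJ hk
      have hd := hθ.length_twist_of_descent hx hs (by have := length_mul_gen hs x; omega)
      obtain ⟨z, hz, hzJ, p, hp, he, hl⟩ := ih _ (by omega) (twist_gen_mem hx hs) rfl
      have e : x = θ (p * k)⁻¹ * z * (p * k) := by
        have h3 : θ (p * k)⁻¹ * z * (p * k) = θ k * (θ p⁻¹ * z * p) * k := by
          simp [gen_inv hs, mul_assoc]
        rw [h3, ← he, mul_assoc, gen_mul_cancel_right hs, ← mul_assoc, ← map_mul,
          gen_mul_self hs]
        simp
      have h4 := hθ.length_twist_le z (p * k)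
      rw [← e] at h4
      have h5 := cs.length_mul_le p k
      rw [length_gen hs] at h5
      exact ⟨z, hz, hzJ, p * k, mul_mem hp (Subgroup.subset_closure hk), e, by omega⟩

theorem twistRank_eq (hx : x ∈ twistedIdentities θ) : 2 * twistRank cs θ x = cs.length x := by
  have lower : ∀ l : List B, cs.length (twistProd cs θ l) ≤ 2 * l.length := by
    intro l
    induction l using List.reverseRecOn with
    | nil => simp [twistProd]
    | append_singleton l i ih =>
      have e : twistProd cs θ (l ++ [i]) = twistAct cs θ (twistProd cs θ l) i := by
        simp [twistProd]
      rw [e, List.length_append, List.length_singleton]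
      have hs : cs.simple i ∈ gens cs := ⟨i, rfl⟩
      unfold twistAct
      split_ifs
      · have := length_mul_gen hs (twistProd cs θ l); omega
      · have := hθ.length_twist_le (twistProd cs θ l) (cs.simple i)
        rw [gen_inv hs, length_gen hs] at this
        omega
  have upper : ∀ l : List B, cs.IsReduced l → IsGood cs θ (cs.wordProd l) →
      twistProd cs θ l = twistElt θ (cs.wordProd l) := by
    intro l
    induction l using List.reverseRecOn with
    | nil => simp [twistProd, twistElt]
    | append_singleton l i ih =>
      intro hl hg
      have hl' := isReduced_of_append_left hl
      have hs : cs.simple i ∈ gens cs := ⟨i, rfl⟩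
      rw [cs.wordProd_append, cs.wordProd_singleton] at hg ⊢
      have hlt : cs.length (cs.wordProd l * cs.simple i) = cs.length (cs.wordProd l) + 1 := by
        rw [← cs.wordProd_singleton, ← cs.wordProd_append, hl.eq, hl'.eq]; simp
      have hg' := hθ.isGood_of_mul_gen hs hg (by omega)
      have e : twistProd cs θ (l ++ [i]) = twistAct cs θ (twistProd cs θ l) i := by
        simp [twistProd]
      rw [e, ih hl' hg', twistElt_mul_gen hs, twistAct, if_neg]
      intro h
      rw [← twistElt_mul_gen hs] at h
      unfold IsGood at hg hg'
      rw [h] at hg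
      omega
  obtain ⟨v, hv, rfl⟩ := hθ.exists_isGood hx
  obtain ⟨l, hl, rfl⟩ := cs.exists_isReduced v
  have hmem : l.length ∈ {k | ∃ l' : List B, l'.length = k ∧
      twistProd cs θ l' = twistElt θ (cs.wordProd l)} := ⟨l, rfl, upper l hl hv⟩
  have h1 : twistRank cs θ (twistElt θ (cs.wordProd l)) ≤ l.length := Nat.sInf_le hmem
  obtain ⟨l', hl', he⟩ := Nat.sInf_mem (Set.nonempty_of_mem hmem)
  change l'.length = twistRank cs θ _ at hl'
  have h2 := lower l'
  rw [he] at h2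
  unfold IsGood at hv
  rw [hl.eq] at hv
  omega

end IsDiagramInvolution

end Twist

/-! ### The geometric representation and a criterion for infiniteness -/

section Geometric

open Real Polynomial

/-- The entries of twice the negated Gram matrix. -/
noncomputable def kappa (M : CoxeterMatrix B) (i j : B) : ℝ := 2 * cos (π / M i j)

theorem kappa_self (M : CoxeterMatrix B) (i : B) : kappa M i i = -2 := by simp [kappa]

theorem kappa_symm (M : CoxeterMatrix B) (i j : B) : kappa M i j = kappa M j i := by
  rw [kappa, M.symmetric]; rfl

theorem two_le_kappa_sq {i j : B} (h : M i j = 0 ∨ 4 ≤ M i j) :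
    0 < kappa M i j ∧ 2 ≤ kappa M i j ^ 2 := by
  have h0 : (√2) ^ 2 = 2 := sq_sqrt (by norm_num)
  have h1 : √2 / 2 ≤ cos (π / M i j) := by
    rcases h with h | h
    · rw [h]
      simp only [Nat.cast_zero, div_zero, cos_zero]
      nlinarith [sqrt_nonneg 2]
    · rw [← cos_pi_div_four]
      have h4 : (4 : ℝ) ≤ M i j := by exact_mod_cast h
      apply cos_le_cos_of_nonneg_of_le_pi
      · positivity
      · linarith [pi_pos]
      · exact div_le_div_of_nonneg_left pi_pos.le (by norm_num) h4
  have h2 : 0 < √2 := sqrt_pos.2 (by norm_num)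
  unfold kappa
  constructor <;> nlinarith

/-- The vector defining the contragredient geometric reflection attached to `i`. -/
noncomputable def geomVec (M : CoxeterMatrix B) (i : B) : B → ℝ := fun j => -kappa M i j

theorem proj_geomVec_self (M : CoxeterMatrix B) (i : B) :
    (LinearMap.proj i : Module.Dual ℝ (B → ℝ)) (geomVec M i) = 2 := by
  simp [geomVec, kappa_self]

/-- The contragredient geometric reflection attached to `i`. -/
noncomputable def geomReflection (M : CoxeterMatrix B) (i : B) : (B → ℝ) ≃ₗ[ℝ] (B → ℝ) :=
  Module.reflection (proj_geomVec_self M i)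

theorem geomReflection_apply (i : B) (f : B → ℝ) (j : B) :
    geomReflection M i f j = f j + kappa M i j * f i := by
  simp [geomReflection, Module.reflection_apply, geomVec]; ring

theorem isLiftable_geomReflection (M : CoxeterMatrix B) : M.IsLiftable (geomReflection M) := by
  intro i j
  by_cases hij : i = j
  · subst hij
    rw [M.diagonal, pow_one]
    ext1 f
    exact Module.involutive_reflection _ f
  generalize hm : M i j = m
  ext1 f
  have hk : kappa M i j = 2 * cos (π / m) := by rw [kappa, hm]
  have hk' : kappa M j i = 2 * cos (π / m) := by rw [kappa_symm, hk]
  have hm1 : m ≠ 1 := by rw [← hm]; exact M.off_diagonal i j hij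
  rcases Nat.eq_zero_or_pos m with rfl | hpos
  · simp
  have hm0 : (m : ℝ) ≠ 0 := by positivity
  by_cases hm2 : m = 2
  · subst hm2
    have h0 : kappa M i j = 0 := by rw [hk]; simp
    have h0' : kappa M j i = 0 := by rw [hk']; simp
    ext l
    simp only [pow_two, LinearEquiv.mul_apply, geomReflection_apply, h0, h0', kappa_self,
      LinearEquiv.coe_one, id]
    ring
  have hm3 : 3 ≤ m := by omega
  have ht : 2 * cos (2 * (π / m)) =
      (LinearMap.proj i : Module.Dual ℝ (B → ℝ)) (geomVec M j) *
        (LinearMap.proj j : Module.Dual ℝ (B → ℝ)) (geomVec M i) - 2 := by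
    simp only [LinearMap.proj_apply, geomVec, hk, hk', cos_two_mul]; ring
  have hsin : sin (2 * (π / m)) ≠ 0 := by
    apply ne_of_gt
    have h3 : (3 : ℝ) ≤ m := by exact_mod_cast hm3
    apply sin_pos_of_pos_of_lt_pi
    · have := pi_pos; positivity
    · rw [← mul_div_assoc, div_lt_iff₀ (by positivity)]
      nlinarith [pi_pos]
  have hS : ∀ n : ℤ, (Chebyshev.S ℝ n).eval (2 * cos (2 * (π / m))) =
      sin ((n + 1) * (2 * (π / m))) / sin (2 * (π / m)) := fun n => by
    rw [eq_div_iff hsin]; exact Chebyshev.S_two_mul_real_cos _ n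
  have key := Module.reflection_mul_reflection_pow_apply (proj_geomVec_self M i)
    (proj_geomVec_self M j) m f _ ht
  change ((geomReflection M i * geomReflection M j) ^ m) f = _ at key
  rw [key, hS, hS, hS, hS]
  rcases Nat.even_or_odd' m with ⟨r, rfl | rfl⟩
  · have e1 : (((2 * r : ℕ) : ℤ) - 2) / 2 = r - 1 := by omega
    have e2 : (((2 * r : ℕ) : ℤ) - 1) / 2 = r - 1 := by omega
    have hs : sin (((((r : ℤ) - 1 : ℤ) : ℝ) + 1) * (2 * (π / ((2 * r : ℕ) : ℝ)))) = 0 := by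
      have : ((((r : ℤ) - 1 : ℤ) : ℝ) + 1) * (2 * (π / ((2 * r : ℕ) : ℝ))) = π := by
        have hr : (r : ℝ) ≠ 0 := by rintro h; apply hm0; push_cast; rw [h]; ring
        push_cast; field_simp; ring
      rw [this, sin_pi]
    rw [e1, e2, hs]
    simp
  · have e1 : (((2 * r + 1 : ℕ) : ℤ) - 2) / 2 = r - 1 := by omega
    have e2 : (((2 * r + 1 : ℕ) : ℤ) - 1) / 2 = r := by omega
    have e3 : (((2 * r + 1 : ℕ) : ℤ) - 3) / 2 = r - 1 := by omega
    have e4 : (((2 * r + 1 : ℕ) : ℤ)) / 2 = r := by omega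
    have hs : sin ((((r : ℤ) : ℝ) + 1) * (2 * (π / ((2 * r + 1 : ℕ) : ℝ)))) =
        - sin (((((r : ℤ) - 1 : ℤ) : ℝ) + 1) * (2 * (π / ((2 * r + 1 : ℕ) : ℝ)))) := by
      have : (((r : ℤ) : ℝ) + 1) * (2 * (π / ((2 * r + 1 : ℕ) : ℝ))) =
          2 * π - ((((r : ℤ) - 1 : ℤ) : ℝ) + 1) * (2 * (π / ((2 * r + 1 : ℕ) : ℝ))) := by
        push_cast at hm0 ⊢; field_simp; ring
      rw [this, sin_two_pi_sub]
    rw [e1, e2, e3, e4, hs]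
    simp [neg_div]

/-- The contragredient geometric representation. -/
noncomputable def geomRep (cs : CoxeterSystem M W) : W →* ((B → ℝ) ≃ₗ[ℝ] (B → ℝ)) :=
  cs.lift ⟨_, isLiftable_geomReflection M⟩

theorem geomRep_simple (cs : CoxeterSystem M W) (i : B) (f : B → ℝ) (j : B) :
    geomRep cs (cs.simple i) f j = f j + kappa M i j * f i := by
  rw [geomRep, cs.lift_apply_simple, geomReflection_apply]

theorem kappa_eq_zero_of_commute (cs : CoxeterSystem M W) {i j : B} (hij : i ≠ j)
    (h : Commute (cs.simple i) (cs.simple j)) : kappa M i j = 0 := by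
  have h1 := congrArg (fun g => geomRep cs g (Pi.single i 1) j) h.eq
  simp only [map_mul, LinearEquiv.mul_apply, geomRep_simple, kappa_self, Pi.single_eq_same,
    Pi.single_eq_of_ne hij.symm, kappa_symm M j i] at h1
  linarith

/-- In a finite Coxeter group, if `a` and `a'` commute then `c` cannot be joined to both of them
by edges of label at least four. -/
theorem not_four_le_of_finite [Finite W] (cs : CoxeterSystem M W) {a a' c : B} (haa : a ≠ a')
    (h : Commute (cs.simple a) (cs.simple a')) (h1 : M c a = 0 ∨ 4 ≤ M c a)
    (h2 : M c a' = 0 ∨ 4 ≤ M c a') : False := by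
  have k0 := kappa_eq_zero_of_commute cs haa h
  have k0' := kappa_eq_zero_of_commute cs haa.symm h.symm
  obtain ⟨p1, q1⟩ := two_le_kappa_sq h1
  obtain ⟨p2, q2⟩ := two_le_kappa_sq h2
  set g := cs.simple a * cs.simple a' * cs.simple c with hg
  set κ := kappa M c a
  set κ' := kappa M c a'
  have step : ∀ f : B → ℝ, geomRep cs g f a = -(f a + κ * f c) ∧
      geomRep cs g f a' = -(f a' + κ' * f c) ∧
      geomRep cs g f c = - f c + κ * (f a + κ * f c) + κ' * (f a' + κ' * f c) := by
    intro f
    simp only [hg, map_mul, LinearEquiv.mul_apply, geomRep_simple, kappa_self, k0, k0',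
      kappa_symm M a c, kappa_symm M a' c]
    refine ⟨?_, ?_, ?_⟩ <;> ring
  have hp : ∀ n : ℕ, 0 < geomRep cs (g ^ n) (Pi.single c 1) c ∧
      0 < 2 * geomRep cs (g ^ n) (Pi.single c 1) c +
        (κ * geomRep cs (g ^ n) (Pi.single c 1) a +
          κ' * geomRep cs (g ^ n) (Pi.single c 1) a') := by
    have hca : a ≠ c := by
      rintro rfl; have := M.diagonal a; omega
    have hca' : a' ≠ c := by
      rintro rfl; have := M.diagonal a'; omega
    intro n
    induction n with
    | zero => simp [Pi.single_eq_of_ne hca, Pi.single_eq_of_ne hca']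
    | succ n ih =>
      obtain ⟨s1, s2, s3⟩ := step (geomRep cs (g ^ n) (Pi.single c 1))
      rw [pow_succ', map_mul, LinearEquiv.mul_apply, s1, s2, s3]
      obtain ⟨i1, i2⟩ := ih
      constructor <;> nlinarith
  have hmono : ∀ n : ℕ, geomRep cs (g ^ n) (Pi.single c 1) c <
      geomRep cs (g ^ (n + 1)) (Pi.single c 1) c := by
    intro n
    obtain ⟨s1, s2, s3⟩ := step (geomRep cs (g ^ n) (Pi.single c 1))
    rw [pow_succ', map_mul, LinearEquiv.mul_apply, s3]
    obtain ⟨i1, i2⟩ := hp n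
    nlinarith
  have hlt := strictMono_nat_of_lt_succ hmono (orderOf_pos g)
  simp only [pow_orderOf_eq_one, pow_zero, lt_irrefl] at hlt

end Geometric

/-! ### Stuck pairs -/

section Structure

variable {cs : CoxeterSystem M W} {θ : W ≃* W} {s t u v x y z p : W} {J : Set W}

/-- The generators in `J` that twisted conjugation at `z` maps to generators in `J`. -/
def stuckGens (θ : W ≃* W) (z : W) (J : Set W) : Set W := {k ∈ J | ∃ m ∈ J, θ k * z = z * m}

/-- The automorphism `θ` conjugated by `z`. -/
def conjTheta (θ : W ≃* W) (z : W) : W →* W :=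
  MonoidHom.mk' (fun h => z⁻¹ * θ h * z) fun a b => by simp [mul_assoc]

theorem mul_conjTheta (z h : W) : z * conjTheta θ z h = θ h * z := by
  simp [conjTheta, mul_assoc]

theorem conjTheta_eq_iff {h h' : W} : conjTheta θ z h = h' ↔ θ h * z = z * h' := by
  rw [← mul_conjTheta, mul_right_inj]

theorem stuckGens_subset : stuckGens θ z J ⊆ J := fun _ h => h.1

theorem conj_mem_gens_of_three [Finite W] {φ : W →* W} {k k' c : W} (hk : k ∈ gens cs)
    (hk' : k' ∈ gens cs) (hc : c ∈ gens cs) (hφk : φ k = k') (hφk' : φ k' = k) (hφc : φ c = c)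
    (hkk : k ≠ k') (hck : c ≠ k) (hck' : c ≠ k') (hcomm : Commute k k')
    (hlen : ∀ x ∈ Subgroup.closure ({k, k', c} : Set W), cs.length (φ x) ≤ cs.length x)
    (hp : p ∈ Subgroup.closure ({k, k', c} : Set W)) (hs : s ∈ ({k, k', c} : Set W))
    (ht : t ∈ ({k, k', c} : Set W)) (hst : s ≠ t)
    (hps : 2 * cs.length p < cs.length (φ p⁻¹ * p * s))
    (hpt : 2 * cs.length p < cs.length (φ p⁻¹ * p * t))
    (hgood : 2 * cs.length p ≤ cs.length (φ p⁻¹ * p)) :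
    p * s * p⁻¹ ∈ gens cs ∨ p * t * p⁻¹ ∈ gens cs := by
  have hJ : ({k, k', c} : Set W) ⊆ gens cs := by
    rintro x (rfl | rfl | rfl) <;> assumption
  have hkC : k ∈ Subgroup.closure ({k, k', c} : Set W) := Subgroup.subset_closure (by simp)
  have hkC' : k' ∈ Subgroup.closure ({k, k', c} : Set W) := Subgroup.subset_closure (by simp)
  have hcC : c ∈ Subgroup.closure ({k, k', c} : Set W) := Subgroup.subset_closure (by simp)
  by_cases h2 : Commute c k
  · have h2' : Commute c k' := by
      have := congrArg φ h2.eq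
      rwa [map_mul, map_mul, hφc, hφk] at this
    left
    have h3 : Commute p s := by
      refine Subgroup.closure_induction (p := fun x _ => Commute x s) ?_ (Commute.one_left _)
        (fun _ _ _ _ ha hb => ha.mul_left hb) (fun _ _ ha => ha.inv_left) hp
      rintro x (rfl | rfl | rfl) <;> rcases hs with rfl | rfl | rfl <;>
        first | exact Commute.refl _ | assumption | (apply Commute.symm; assumption)
    rw [h3.eq, mul_inv_cancel_right]
    exact hJ hs
  have pre : ∀ a b, p = a * b → b ∈ Subgroup.closure ({k, k', c} : Set W) →
      cs.length (φ a⁻¹ * a) + 2 * cs.length b < 2 * cs.length p → False := by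
    rintro a b rfl hb hlt
    have e : φ (a * b)⁻¹ * (a * b) = φ b⁻¹ * (φ a⁻¹ * a) * b := by
      simp [mul_assoc]
    rw [e] at hgood
    have h1 := cs.length_mul_le (φ b⁻¹ * (φ a⁻¹ * a)) b
    have h3 := cs.length_mul_le (φ b⁻¹) (φ a⁻¹ * a)
    have h4 := hlen _ (inv_mem hb)
    rw [cs.length_inv] at h4
    omega
  have hpasc : ∀ x ∈ ({k, k', c} : Set W), 2 * cs.length p < cs.length (φ p⁻¹ * p * x) →
      cs.length p < cs.length (p * x) := by
    intro x hx h
    rw [mul_assoc] at h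
    have h1 := cs.length_mul_le (φ p⁻¹) (p * x)
    have h4 := hlen _ (inv_mem hp)
    rw [cs.length_inv] at h4
    have := length_mul_gen (hJ hx) p
    omega
  have hps' := hpasc s hs hps
  have hpt' := hpasc t ht hpt
  by_cases h3 : k * c * k = c * k * c
  · have h3' : k' * c * k' = c * k' * c := by
      have := congrArg φ h3
      simpa only [map_mul, hφc, hφk] using this
    -- the argument is symmetric in `k` and `k'`, so it is carried out once for a pair `(a, a')`
    have main : ∀ a a', (a = k ∧ a' = k') ∨ (a = k' ∧ a' = k) → ∀ p1,
        p1 ∈ Subgroup.closure ({k, k', c} : Set W) → p = a * p1 →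
        cs.length p = cs.length p1 + 1 → p * s * p⁻¹ ∈ gens cs ∨ p * t * p⁻¹ ∈ gens cs := by
      intro a a' haa p1 hp1 he hl
      have ha : a ∈ gens cs := by rcases haa with ⟨rfl, rfl⟩ | ⟨rfl, rfl⟩ <;> assumption
      have ha' : a' ∈ gens cs := by rcases haa with ⟨rfl, rfl⟩ | ⟨rfl, rfl⟩ <;> assumption
      have hφa : φ a = a' := by rcases haa with ⟨rfl, rfl⟩ | ⟨rfl, rfl⟩ <;> assumption
      have hca : Commute a a' := by
        rcases haa with ⟨rfl, rfl⟩ | ⟨rfl, rfl⟩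
        · assumption
        · exact hcomm.symm
      have hb : a * c * a = c * a * c := by rcases haa with ⟨rfl, rfl⟩ | ⟨rfl, rfl⟩ <;> assumption
      have hb' : a' * c * a' = c * a' * c := by
        rcases haa with ⟨rfl, rfl⟩ | ⟨rfl, rfl⟩ <;> assumption
      have hmem : ∀ x ∈ ({k, k', c} : Set W), x = a ∨ x = a' ∨ x = c := by
        rintro x (rfl | rfl | rfl) <;> rcases haa with ⟨rfl, rfl⟩ | ⟨rfl, rfl⟩ <;> simp
      have haC : a ∈ Subgroup.closure ({k, k', c} : Set W) := by
        rcases haa with ⟨rfl, rfl⟩ | ⟨rfl, rfl⟩ <;> assumption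
      by_cases hp1' : p1 = 1
      · exfalso
        rw [hp1', mul_one] at he
        have hx : ∀ x ∈ ({k, k', c} : Set W), 2 * cs.length p < cs.length (φ p⁻¹ * p * x) →
            x = c := by
          intro x hx h
          rw [he, length_gen ha, gen_inv ha, hφa] at h
          rcases hmem x hx with rfl | rfl | rfl
          · rw [gen_mul_cancel_right ha, length_gen ha'] at h; omega
          · rw [← hca.eq, gen_mul_cancel_right ha', length_gen ha] at h; omega
          · rfl
        exact hst ((hx s hs hps).trans (hx t ht hpt).symm)
      obtain ⟨m, hm, p2, hp2, rfl, hl2⟩ := exists_left_descent_of_mem_closure hJ hp1 hp1'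
      rcases hmem m hm with rfl | rfl | rfl
      · rw [gen_mul_cancel_left ha] at he
        rw [he] at hl; omega
      · exfalso
        refine pre (a * m) p2 (by rw [he, mul_assoc]) hp2 ?_
        have : φ (a * m)⁻¹ * (a * m) = 1 := by
          rw [mul_inv_rev, gen_inv ha, gen_inv ha', map_mul, hφa]
          have : φ m = a := by rcases haa with ⟨rfl, rfl⟩ | ⟨rfl, rfl⟩ <;> assumption
          rw [this, mul_assoc, hca.eq, gen_mul_cancel_left ha', gen_mul_self ha]
        rw [this, cs.length_one]; omega
      by_cases hp2' : p2 = 1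
      · rw [hp2', mul_one] at he
        have key : a * m * a * (a * m)⁻¹ = m := by
          rw [hb, mul_inv_rev, gen_inv ha, gen_inv hc]
          simp only [← mul_assoc]
          rw [gen_mul_cancel_right hc, gen_mul_cancel_right ha]
        have hnc : ∀ x ∈ ({k, k', m} : Set W), cs.length p < cs.length (p * x) →
            x = a ∨ x = a' := by
          intro x hx h
          rcases hmem x hx with rfl | rfl | rfl
          · simp
          · simp
          · have h5 := hl
            rw [he] at h5
            rw [he, gen_mul_cancel_right hc, length_gen ha] at h
            omega
        rw [he]
        rcases hnc s hs hps' with rfl | rfl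
        · left; rwa [key]
        · rcases hnc t ht hpt' with rfl | rfl
          · right; rwa [key]
          · exact absurd rfl hst
      exfalso
      obtain ⟨m', hm', p3, hp3, rfl, hl3⟩ := exists_left_descent_of_mem_closure hJ hp2 hp2'
      rcases hmem m' hm' with rfl | rfl | rfl
      · refine pre m (m' * m * p3) ?_ (mul_mem (mul_mem haC hcC) hp3) ?_
        · rw [he]
          simp only [← mul_assoc]
          rw [hb]
        · rw [gen_inv hc, hφc, gen_mul_self hc, cs.length_one]
          have h5 := cs.length_mul_le (m' * m) p3
          have h6 := cs.length_mul_le m' m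
          rw [length_gen ha, length_gen hc] at h6
          omega
      · refine pre (a * m * m') p3 ?_ hp3 ?_
        · rw [he]; simp only [mul_assoc]
        · have hφa' : φ m' = a := by rcases haa with ⟨rfl, rfl⟩ | ⟨rfl, rfl⟩ <;> assumption
          have : φ (a * m * m')⁻¹ * (a * m * m') = m * a * m' * m := by
            rw [mul_inv_rev, mul_inv_rev, gen_inv ha, gen_inv hc, gen_inv ha', map_mul, map_mul,
              hφa', hφc, hφa]
            calc a * (m * m') * (a * m * m') = a * m * (m' * a) * m * m' := by
                  simp only [mul_assoc]
              _ = (a * m * a) * (m' * m * m') := by rw [← hca.eq]; simp only [mul_assoc]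
              _ = m * a * (m * m) * m' * m := by rw [hb, hb']; simp only [mul_assoc]
              _ = m * a * m' * m := by rw [gen_mul_self hc, mul_one]
          rw [this]
          have h5 := cs.length_mul_le (m * a * m') m
          have h6 := cs.length_mul_le (m * a) m'
          have h7 := cs.length_mul_le m a
          rw [length_gen ha'] at h6
          rw [length_gen ha, length_gen hc] at h7
          rw [length_gen hc] at h5
          omega
      · rw [gen_mul_cancel_left hc] at he
        have := cs.length_mul_le a p3
        rw [length_gen ha] at this
        rw [he] at hl
        omega
    by_cases hp0 : p = 1
    · left; rw [hp0]; simpa using hJ hs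
    obtain ⟨m, hm, p1, hp1, he, hl⟩ := exists_left_descent_of_mem_closure hJ hp hp0
    rcases hm with rfl | rfl | rfl
    · exact main _ _ (Or.inl ⟨rfl, rfl⟩) p1 hp1 he hl
    · exact main _ _ (Or.inr ⟨rfl, rfl⟩) p1 hp1 he hl
    · exfalso
      refine pre m p1 he hp1 ?_
      rw [gen_inv hc, hφc, gen_mul_self hc, cs.length_one]
      omega
  · exfalso
    obtain ⟨i, rfl⟩ := hk
    obtain ⟨i', rfl⟩ := hk'
    obtain ⟨j, rfl⟩ := hc
    have big : ∀ i, cs.simple j ≠ cs.simple i → ¬ Commute (cs.simple j) (cs.simple i) →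
        cs.simple i * cs.simple j * cs.simple i ≠ cs.simple j * cs.simple i * cs.simple j →
        M j i = 0 ∨ 4 ≤ M j i := by
      intro i h1 h2 h3
      have hp := cs.simple_mul_simple_pow j i
      by_contra! h4
      have h5 : M j i = 1 ∨ M j i = 2 ∨ M j i = 3 := by omega
      rcases h5 with h5 | h5 | h5
      · rw [h5, pow_one] at hp
        exact h1 (by rw [mul_eq_one_iff_eq_inv.1 hp, cs.inv_simple])
      · rw [h5, sq] at hp
        apply h2
        have := mul_eq_one_iff_eq_inv.1 hp
        rwa [mul_inv_rev, cs.inv_simple, cs.inv_simple] at this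
      · rw [h5, pow_succ, sq] at hp
        apply h3
        have : cs.simple j * cs.simple i * cs.simple j *
            (cs.simple i * cs.simple j * cs.simple i) = 1 := by
          rw [← hp]; simp only [mul_assoc]
        have := mul_eq_one_iff_eq_inv.1 this
        rw [this]; simp [mul_assoc]
    refine not_four_le_of_finite cs (c := j) (a := i) (a' := i') ?_ hcomm
      (big i hck h2 h3) (big i' hck' ?_ ?_)
    · rintro rfl; exact hkk rfl
    · intro h4
      apply h2
      have := congrArg φ h4.eq
      rwa [map_mul, map_mul, hφc, hφk'] at this
    · intro h4
      apply h3
      have := congrArg φ h4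
      simpa only [map_mul, hφc, hφk'] using this

namespace IsDiagramInvolution

variable (hθ : IsDiagramInvolution cs θ)
include hθ

theorem image_subset_gens (hJ : J ⊆ gens cs) : θ '' J ⊆ gens cs := by
  rintro _ ⟨k, hk, rfl⟩; exact hθ.map_gens _ (hJ hk)

theorem length_map_mul_of_ascents (hJ : J ⊆ gens cs) (hz : z ∈ twistedIdentities θ)
    (hzJ : ∀ k ∈ J, cs.length z < cs.length (z * k)) {h : W} (hh : h ∈ Subgroup.closure J) :
    cs.length (θ h * z) = cs.length h + cs.length z := by
  rw [length_mul_of_left_ascents (J := θ '' J) (hθ.image_subset_gens hJ), hθ.length_map]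
  · rintro _ ⟨k, hk, rfl⟩
    rw [hθ.length_map_gen_mul hz (hJ hk)]; exact hzJ k hk
  · have := Subgroup.mem_map_of_mem θ.toMonoidHom hh
    rw [MonoidHom.map_closure] at this
    exact this

/-- Distinct minimal twisted double coset representatives are never related by `W_J`. -/
theorem eq_of_map_mul_eq (hJ : J ⊆ gens cs) (hz : z ∈ twistedIdentities θ)
    (hzJ : ∀ k ∈ J, cs.length z < cs.length (z * k)) {z' : W} (hz' : z' ∈ twistedIdentities θ)
    (hzJ' : ∀ k ∈ J, cs.length z' < cs.length (z' * k)) {h h' : W}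
    (hh : h ∈ Subgroup.closure J) (hh' : h' ∈ Subgroup.closure J) (he : θ h * z = z' * h') :
    z = z' ∧ h ∈ Subgroup.closure (stuckGens θ z J) := by
  induction hn : cs.length h generalizing h h' with
  | zero =>
    rw [cs.length_eq_zero_iff] at hn
    subst hn
    rw [map_one, one_mul] at he
    by_cases h1 : h' = 1
    · exact ⟨by rw [he, h1, mul_one], one_mem _⟩
    · obtain ⟨k, hk, g, hg, rfl, hl⟩ := exists_right_descent_of_mem_closure hJ hh' h1
      have h2 := hzJ k hk
      rw [he, ← mul_assoc, gen_mul_cancel_right (hJ hk), mul_assoc,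
        length_mul_of_ascents hJ hzJ' hh', length_mul_of_ascents hJ hzJ' hg] at h2
      omega
  | succ n ih =>
    have h1 : h ≠ 1 := by rintro rfl; simp at hn
    obtain ⟨k, hk, g, hg, rfl, hl⟩ := exists_left_descent_of_mem_closure hJ hh h1
    have hkg := hθ.map_gens _ (hJ hk)
    have e1 : θ g * z = θ k * z' * h' := by
      rw [mul_assoc, ← he, map_mul, mul_assoc, gen_mul_cancel_left hkg]
    set r := z'⁻¹ * θ k * z' with hr
    set ρ := h'⁻¹ * r * h' with hρ
    have hrr : cs.IsReflection r := by
      have := (isReflection_of_mem_gens hkg).conj z'⁻¹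
      rwa [inv_inv] at this
    have hρr : cs.IsReflection ρ := by
      have := hrr.conj h'⁻¹
      rwa [inv_inv] at this
    have hlt : cs.length (z' * h' * ρ) < cs.length (z' * h') := by
      have e2 : z' * h' * ρ = θ g * z := by rw [e1]; simp [hρ, hr, mul_assoc]
      rw [e2, ← he, hθ.length_map_mul_of_ascents hJ hz hzJ hg,
        hθ.length_map_mul_of_ascents hJ hz hzJ hh]
      omega
    have e3 : z' * r = θ k * z' := by simp [hr, mul_assoc]
    have hlt2 : cs.length (h' * ρ) < cs.length h' := by
      have h4 := (length_mul_mul_lt_iff cs hρr _ _).1 hlt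
      have e4 : z' * (h' * ρ * h'⁻¹) = θ k * z' := by rw [← e3]; simp [hρ, mul_assoc]
      rw [e4, hθ.length_map_gen_mul hz' (hJ hk)] at h4
      have := hzJ' k hk
      by_contra h5
      exact h4 (iff_of_false h5 (by omega))
    have hrC : r ∈ Subgroup.closure J := by
      have := reflection_mem_closure hJ hh' hρr hlt2
      have := mul_mem (mul_mem hh' this) (inv_mem hh')
      simpa [hρ, mul_assoc] using this
    have hr1 : cs.length r = 1 := by
      have h5 := length_mul_of_ascents hJ hzJ' hrC
      rw [e3, hθ.length_map_gen_mul hz' (hJ hk)] at h5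
      have h6 := length_mul_gen_of_lt (hJ hk) (hzJ' k hk)
      omega
    have hrJ : r ∈ J := by
      obtain ⟨i, hi⟩ := cs.length_eq_one_iff.1 hr1
      exact mem_of_gen_mem_closure hJ ⟨i, hi.symm⟩ hrC
    obtain ⟨rfl, hg'⟩ := ih hg (mul_mem hrC hh') (by rw [e1, ← e3, mul_assoc]) (by omega)
    exact ⟨rfl, mul_mem (Subgroup.subset_closure ⟨hk, r, hrJ, e3.symm⟩) hg'⟩

theorem conjTheta_conjTheta (hz : z ∈ twistedIdentities θ) (h : W) :
    conjTheta θ z (conjTheta θ z h) = h := by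
  simp [conjTheta, hθ.map_eq_inv hz, hθ.apply_apply, mul_assoc]

theorem conjTheta_mem_stuckGens (hz : z ∈ twistedIdentities θ) {k : W}
    (hk : k ∈ stuckGens θ z J) : conjTheta θ z k ∈ stuckGens θ z J := by
  obtain ⟨hk, k', hk', h⟩ := hk
  rw [conjTheta_eq_iff.2 h]
  exact ⟨hk', k, hk, hθ.map_mul_eq_symm hz h⟩

theorem length_conjTheta (hJ : J ⊆ gens cs) (hz : z ∈ twistedIdentities θ)
    (hzJ : ∀ k ∈ J, cs.length z < cs.length (z * k)) {h : W}
    (hh : h ∈ Subgroup.closure (stuckGens θ z J)) :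
    conjTheta θ z h ∈ Subgroup.closure (stuckGens θ z J) ∧
      cs.length (conjTheta θ z h) = cs.length h := by
  have h1 : conjTheta θ z h ∈ Subgroup.closure (stuckGens θ z J) := by
    have := Subgroup.mem_map_of_mem (conjTheta θ z) hh
    rw [MonoidHom.map_closure] at this
    refine Subgroup.closure_mono ?_ this
    rintro _ ⟨k, hk, rfl⟩
    exact hθ.conjTheta_mem_stuckGens hz hk
  refine ⟨h1, ?_⟩
  have hm := Subgroup.closure_mono (stuckGens_subset (θ := θ) (z := z) (J := J))
  have h2 := length_mul_of_ascents hJ hzJ (hm h1)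
  rw [mul_conjTheta, hθ.length_map_mul_of_ascents hJ hz hzJ (hm hh)] at h2
  omega

end IsDiagramInvolution

end Structure

section Stuck

variable {cs : CoxeterSystem M W} {θ : W ≃* W} {s t u v x y z p : W} {J : Set W}

theorem eq_one_or_eq_of_mem_closure {K : Set W} {k h : W} (hk : k * k = 1) (hK : K ⊆ {k})
    (hh : h ∈ Subgroup.closure K) : h = 1 ∨ h = k := by
  have hi : k⁻¹ = k := inv_eq_of_mul_eq_one_left hk
  refine Subgroup.closure_induction (p := fun h _ => h = 1 ∨ h = k) ?_ (Or.inl rfl) ?_ ?_ hh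
  · intro x hx; exact Or.inr (hK hx)
  · rintro _ _ - - (rfl | rfl) (rfl | rfl) <;> simp [hk]
  · rintro _ - (rfl | rfl) <;> simp [hi]

theorem mem_four_of_mem_closure {K : Set W} {k k' h : W} (hk : k * k = 1) (hk' : k' * k' = 1)
    (hc : Commute k k') (hK : K ⊆ {k, k'}) (hh : h ∈ Subgroup.closure K) :
    h = 1 ∨ h = k ∨ h = k' ∨ h = k * k' := by
  have key : ∀ a ∈ K, ∀ h, (h = 1 ∨ h = k ∨ h = k' ∨ h = k * k') →
      (a * h = 1 ∨ a * h = k ∨ a * h = k' ∨ a * h = k * k') := by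
    intro a ha h hh
    have hkk : k * (k * k') = k' := by rw [← mul_assoc, hk, one_mul]
    have hkk' : k' * (k * k') = k := by rw [hc.eq, ← mul_assoc, hk', one_mul]
    have hkk2 : k' * k = k * k' := hc.eq.symm
    rcases hK ha with rfl | ha
    · rcases hh with rfl | rfl | rfl | rfl <;> simp [hk, hkk]
    · obtain rfl : a = k' := ha
      rcases hh with rfl | rfl | rfl | rfl <;> simp [hk', hkk', hkk2]
  have hinv : ∀ a ∈ K, a⁻¹ = a := by
    intro a ha
    rcases hK ha with rfl | ha
    · exact inv_eq_of_mul_eq_one_left hk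
    · obtain rfl : a = k' := ha
      exact inv_eq_of_mul_eq_one_left hk'
  refine Subgroup.closure_induction_left
    (p := fun h _ => h = 1 ∨ h = k ∨ h = k' ∨ h = k * k') (Or.inl rfl) ?_ ?_ hh
  · intro a ha h _ ih; exact key a ha h ih
  · intro a ha h _ ih; rw [hinv a ha]; exact key a ha h ih

namespace IsDiagramInvolution

variable (hθ : IsDiagramInvolution cs θ)
include hθ

theorem exists_stuck_conj_of_forall_lt [Finite W] (hy : y ∈ twistedIdentities θ)
    (ih : ∀ z ∈ twistedIdentities θ, cs.length z < cs.length y → ∀ a ∈ gens cs, ∀ b ∈ gens cs,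
      θ b * z = z * a → cs.length z < cs.length (z * a) → Commute a b)
    (hy1 : y ≠ 1) (hs : s ∈ gens cs) (ht : t ∈ gens cs) (h : θ t * y = y * s)
    (hlt : cs.length y < cs.length (y * s)) :
    ∃ z ∈ twistedIdentities θ, ∃ p, p ≠ 1 ∧ y = θ p⁻¹ * z * p ∧
      cs.length y = cs.length z + 2 * cs.length p ∧ ∃ k ∈ gens cs, ∃ k' ∈ gens cs,
        p * s = k * p ∧ p * t = k' * p ∧ cs.length (p * s) = cs.length p + 1 ∧
        cs.length (p * t) = cs.length p + 1 ∧ θ k' * z = z * k ∧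
        cs.length z < cs.length (z * k) ∧ Commute k k' := by
  obtain ⟨i, hi⟩ := cs.exists_rightDescent_of_ne_one hy1
  obtain ⟨r, hr, hir⟩ : ∃ r ∈ gens cs, cs.length (y * r) < cs.length y := ⟨_, ⟨i, rfl⟩, hi⟩
  clear hi i
  have hJ : ({r, s, t} : Set W) ⊆ gens cs := by rintro x (rfl | rfl | rfl) <;> assumption
  have hrC : r ∈ ({r, s, t} : Set W) := by simp
  have hsC : s ∈ ({r, s, t} : Set W) := by simp
  have htC : t ∈ ({r, s, t} : Set W) := by simp
  obtain ⟨z, hz, hzJ, p, hp, he, hl⟩ := hθ.exists_descent hJ hy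
  have hp1 : p ≠ 1 := by
    rintro rfl
    simp only [inv_one, map_one, one_mul, mul_one] at he
    have := hzJ r hrC
    rw [he] at hir; omega
  have hlp : cs.length p ≠ 0 := by rwa [Ne, cs.length_eq_zero_iff]
  have hlt' : cs.length y < cs.length (y * t) := by
    rw [← hθ.map_mul_eq_symm hy h, hθ.length_map_gen_mul hy hs]; exact hlt
  have hasc : ∀ x ∈ gens cs, cs.length y < cs.length (y * x) →
      cs.length (p * x) = cs.length p + 1 := by
    intro x hx hxy
    have h1 := length_mul_gen hx p
    have h2 := cs.length_mul_le (θ p⁻¹ * z) (p * x)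
    have h3 := cs.length_mul_le (θ p⁻¹) z
    rw [hθ.length_map, cs.length_inv] at h3
    have : y * x = θ p⁻¹ * z * (p * x) := by rw [he]; simp only [mul_assoc]
    rw [this] at hxy
    omega
  set K := stuckGens θ z {r, s, t} with hK
  have hKJ : K ⊆ gens cs := stuckGens_subset.trans hJ
  have hpairs : ∀ c ∈ ({r, s, t} : Set W), ∀ d ∈ ({r, s, t} : Set W), θ d * y = y * c →
      θ (p * d * p⁻¹) * z = z * (p * c * p⁻¹) ∧ p * d * p⁻¹ ∈ Subgroup.closure K := by
    intro c hc d hd h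
    have e : θ (p * d * p⁻¹) * z = z * (p * c * p⁻¹) := by
      rw [he] at h
      have := congrArg (fun x => θ p * x * p⁻¹) h
      simpa [mul_assoc] using this
    refine ⟨e, (hθ.eq_of_map_mul_eq hJ hz hzJ hz hzJ ?_ ?_ e).2⟩
    · exact mul_mem (mul_mem hp (Subgroup.subset_closure hd)) (inv_mem hp)
    · exact mul_mem (mul_mem hp (Subgroup.subset_closure hc)) (inv_mem hp)
  obtain ⟨hba, hbK⟩ := hpairs s hsC t htC h
  obtain ⟨hab, haK⟩ := hpairs t htC s hsC (hθ.map_mul_eq_symm hy h)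
  set a := p * s * p⁻¹ with ha
  set b := p * t * p⁻¹ with hb
  have hφb := conjTheta_eq_iff.2 hba
  have hφa := conjTheta_eq_iff.2 hab
  have hpa : p * s = a * p := by simp [ha]
  have hpb : p * t = b * p := by simp [hb]
  have harefl : cs.IsReflection a := (isReflection_of_mem_gens hs).conj p
  suffices hab' : a ∈ gens cs ∨ b ∈ gens cs by
    have haK' : a ∈ K ∧ b ∈ K := by
      rcases hab' with h1 | h1
      · have := mem_of_gen_mem_closure hKJ h1 haK
        exact ⟨this, hφa ▸ hθ.conjTheta_mem_stuckGens hz this⟩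
      · have := mem_of_gen_mem_closure hKJ h1 hbK
        exact ⟨hφb ▸ hθ.conjTheta_mem_stuckGens hz this, this⟩
    obtain ⟨ha', hb'⟩ := haK'
    have hza := hzJ a ha'.1
    exact ⟨z, hz, p, hp1, he, hl, a, hKJ ha', b, hKJ hb', hpa, hpb, hasc s hs hlt,
      hasc t ht hlt', hba, hza, ih z hz (by omega) a (hKJ ha') b (hKJ hb') hba hza⟩
  by_cases hfix : ∀ k ∈ K, conjTheta θ z k = k
  · have hfix' : ∀ h ∈ Subgroup.closure K, conjTheta θ z h = h := fun h hh =>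
      MonoidHom.eqOn_closure (f := conjTheta θ z) (g := MonoidHom.id W) hfix hh
    left
    have hst : s = t := by
      have : a = b := by rw [← hφa, hfix' a haK]
      simpa [ha, hb] using this
    subst hst
    have hnot : ¬ (r ∈ K ∧ s ∈ K) := by
      rintro ⟨h1, h2⟩
      have hpK : p ∈ Subgroup.closure K := by
        refine Subgroup.closure_mono ?_ hp
        rintro x (rfl | rfl | rfl) <;> assumption
      have h3 := mul_conjTheta (θ := θ) z p⁻¹
      rw [map_inv, hfix' p hpK] at h3
      rw [← h3] at he
      rw [inv_mul_cancel_right] at he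
      rw [he] at hl; omega
    obtain ⟨k, hk, hkK⟩ : ∃ k ∈ gens cs, K ⊆ {k} := by
      by_cases h1 : r ∈ K
      · refine ⟨r, hr, fun x hx => ?_⟩
        rcases hx.1 with rfl | rfl | rfl
        · rfl
        · exact absurd ⟨h1, hx⟩ hnot
        · exact absurd ⟨h1, hx⟩ hnot
      · refine ⟨s, hs, fun x hx => ?_⟩
        rcases hx.1 with rfl | rfl | rfl
        · exact absurd hx h1
        · rfl
        · rfl
    rcases eq_one_or_eq_of_mem_closure (gen_mul_self hk) hkK haK with h1 | h1
    · have := harefl.odd_length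
      rw [h1] at this; simp at this
    · rwa [h1]
  push Not at hfix
  obtain ⟨k, hkK, hne⟩ := hfix
  set k' := conjTheta θ z k with hk'
  have hkK' : k' ∈ K := hθ.conjTheta_mem_stuckGens hz hkK
  have hk'k : conjTheta θ z k' = k := hθ.conjTheta_conjTheta hz k
  have hcomm : Commute k k' :=
    ih z hz (by omega) k (hKJ hkK) k' (hKJ hkK') (conjTheta_eq_iff.1 hk'k) (hzJ k hkK.1)
  by_cases hK2 : K ⊆ {k, k'}
  · left
    rcases mem_four_of_mem_closure (gen_mul_self (hKJ hkK)) (gen_mul_self (hKJ hkK')) hcomm hK2 haK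
      with h1 | h1 | h1 | h1
    · have := harefl.odd_length
      rw [h1] at this; simp at this
    · rw [h1]; exact hKJ hkK
    · rw [h1]; exact hKJ hkK'
    · have := harefl.odd_length
      have h2 := length_mul_gen (hKJ hkK') k
      rw [length_gen (hKJ hkK), ← h1] at h2
      obtain ⟨m, hm⟩ := this
      omega
  · rw [Set.not_subset] at hK2
    obtain ⟨c, hcK, hc⟩ := hK2
    have hck : c ≠ k := by rintro rfl; simp at hc
    have hck' : c ≠ k' := by intro h1; exact hc (by simp [h1])
    have hall : s ≠ t ∧ ∀ x ∈ ({r, s, t} : Set W), x = k ∨ x = k' ∨ x = c := by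
      have h1 := hkK.1
      have h2 := hkK'.1
      have h3 := hcK.1
      simp only [Set.mem_insert_iff, Set.mem_singleton_iff] at h1 h2 h3 ⊢
      clear_value k'
      grind
    have hPK : ({r, s, t} : Set W) ⊆ K := by
      intro x hx
      rcases hall.2 x hx with rfl | rfl | rfl <;> assumption
    have hset : ({k, k', c} : Set W) = {r, s, t} := by
      apply Set.Subset.antisymm
      · rintro x (rfl | rfl | rfl)
        · exact hkK.1
        · exact hkK'.1
        · exact hcK.1
      · intro x hx
        rcases hall.2 x hx with h1 | h1 | h1 <;> simp [h1]
    have hφc : conjTheta θ z c = c := by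
      have h1 := hθ.conjTheta_mem_stuckGens hz hcK
      have h2 := hθ.conjTheta_conjTheta hz c
      rcases hall.2 _ h1.1 with h3 | h3 | h3
      · rw [h3] at h2; exact absurd h2.symm hck'
      · rw [h3, hk'k] at h2; exact absurd h2.symm hck
      · exact h3
    have hPc : Subgroup.closure ({r, s, t} : Set W) ≤ Subgroup.closure K :=
      Subgroup.closure_mono hPK
    have hφmem : ∀ x ∈ Subgroup.closure ({r, s, t} : Set W),
        conjTheta θ z x ∈ Subgroup.closure ({r, s, t} : Set W) := fun x hx =>
      Subgroup.closure_mono stuckGens_subset (hθ.length_conjTheta hJ hz hzJ (hPc hx)).1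
    have hyz : y = z * (conjTheta θ z p⁻¹ * p) := by rw [← mul_assoc, mul_conjTheta, he]
    have hyl : ∀ x ∈ Subgroup.closure ({r, s, t} : Set W), cs.length (y * x) =
        cs.length z + cs.length (conjTheta θ z p⁻¹ * p * x) := by
      intro x hx
      rw [hyz, mul_assoc z, length_mul_of_ascents hJ hzJ]
      exact mul_mem (mul_mem (hφmem _ (inv_mem hp)) hp) hx
    have hyl1 := hyl 1 (one_mem _)
    rw [mul_one, mul_one] at hyl1
    have hyls := hyl s (Subgroup.subset_closure hsC)
    have hylt := hyl t (Subgroup.subset_closure htC)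
    refine conj_mem_gens_of_three (φ := conjTheta θ z) (hKJ hkK) (hKJ hkK') (hKJ hcK) rfl hk'k hφc
      hne.symm hck hck' hcomm ?_ ?_ ?_ ?_ hall.1 ?_ ?_ ?_
    · rw [hset]; exact fun x hx => (hθ.length_conjTheta hJ hz hzJ (hPc hx)).2.le
    · rwa [hset]
    · rwa [hset]
    · rwa [hset]
    · omega
    · omega
    · omega

variable (hcomm : ∀ s ∈ gens cs, Commute s (θ s))
include hcomm

theorem commute_of_stuck [Finite W] (hy : y ∈ twistedIdentities θ) (hs : s ∈ gens cs)
    (ht : t ∈ gens cs) (h : θ t * y = y * s) (hlt : cs.length y < cs.length (y * s)) :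
    Commute s t := by
  induction hn : cs.length y using Nat.strong_induction_on generalizing y s t with
  | _ n ih =>
    by_cases hy1 : y = 1
    · rw [hy1, mul_one, one_mul] at h
      rw [← h]
      exact (hcomm t ht).symm
    · obtain ⟨z, -, p, -, -, -, k, -, k', -, h1, h2, -, -, -, -, hc⟩ :=
        hθ.exists_stuck_conj_of_forall_lt hy
          (fun z hz hl a ha b hb h1 h2 => ih _ (by omega) hz ha hb h1 h2 rfl) hy1 hs ht h hlt
      have e1 : s = p⁻¹ * k * p := by rw [mul_assoc, ← h1, inv_mul_cancel_left]
      have e2 : t = p⁻¹ * k' * p := by rw [mul_assoc, ← h2, inv_mul_cancel_left]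
      rw [e1, e2, commute_iff_eq]
      simp only [mul_assoc, mul_inv_cancel_left]
      rw [← mul_assoc k, hc.eq, mul_assoc]

theorem exists_stuck_conj [Finite W] (hy : y ∈ twistedIdentities θ)
    (hy1 : y ≠ 1) (hs : s ∈ gens cs) (ht : t ∈ gens cs) (h : θ t * y = y * s)
    (hlt : cs.length y < cs.length (y * s)) :
    ∃ z ∈ twistedIdentities θ, ∃ p, p ≠ 1 ∧ y = θ p⁻¹ * z * p ∧
      cs.length y = cs.length z + 2 * cs.length p ∧ ∃ k ∈ gens cs, ∃ k' ∈ gens cs,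
        p * s = k * p ∧ p * t = k' * p ∧ cs.length (p * s) = cs.length p + 1 ∧
        cs.length (p * t) = cs.length p + 1 ∧ θ k' * z = z * k ∧
        cs.length z < cs.length (z * k) ∧ Commute k k' :=
  hθ.exists_stuck_conj_of_forall_lt hy
    (fun _ hz _ _ ha _ hb h1 h2 => hθ.commute_of_stuck hcomm hz ha hb h1 h2) hy1 hs ht h hlt

end IsDiagramInvolution

end Stuck

section Spherical

variable {cs : CoxeterSystem M W} {θ : W ≃* W} {s t u v x y z p : W} {J : Set W}

theorem conjTheta_ne_self (hp : p ≠ 1)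
    (hx : x = θ p⁻¹ * z * p) (hl : cs.length x = cs.length z + 2 * cs.length p) :
    conjTheta θ z p ≠ p := by
  intro h
  have h1 := conjTheta_eq_iff.1 h
  have h2 : x = z := by
    rw [hx, mul_assoc, ← h1, ← mul_assoc, ← map_mul]; simp
  rw [h2] at hl
  exact hp (cs.length_eq_zero_iff.1 (by omega))

variable {A : Type*} [CommRing A] {q : A} {ψ : W → A}

/-- For a spherical vector `ψ`, the function `heckeBasis cs q v ψ` depends only on the twisted
identity of `v`, and it inherits the sphericity of `ψ` at stuck pairs. -/
theorem IsDiagramInvolution.heckeBasis_spherical [Finite W] (hθ : IsDiagramInvolution cs θ)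
    (hcomm : ∀ s ∈ gens cs, Commute s (θ s))
    (hψ1 : ∀ s ∈ gens cs, heckeR cs q s ψ = heckeR cs q (θ s) ψ)
    (hψ2 : ∀ s ∈ gens cs, θ s = s → heckeR cs q s ψ = q • ψ) (n : ℕ) :
    (∀ v v', IsGood cs θ v → IsGood cs θ v' → cs.length v = n → twistElt θ v = twistElt θ v' →
      heckeBasis cs q v ψ = heckeBasis cs q v' ψ) ∧
    (∀ v, IsGood cs θ v → cs.length v = n → ∀ s ∈ gens cs, ∀ t ∈ gens cs,
      θ t * twistElt θ v = twistElt θ v * s →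
      cs.length (twistElt θ v) < cs.length (twistElt θ v * s) →
      heckeR cs q s (heckeBasis cs q v ψ) = heckeR cs q t (heckeBasis cs q v ψ) ∧
      (s = t → heckeR cs q s (heckeBasis cs q v ψ) = q • heckeBasis cs q v ψ)) := by
  induction n using Nat.strong_induction_on with
  | _ n ih =>
    have hU : ∀ v v', IsGood cs θ v → IsGood cs θ v' → cs.length v = n →
        twistElt θ v = twistElt θ v' → heckeBasis cs q v ψ = heckeBasis cs q v' ψ := by
      intro v v' hv hv' hn he
      have hn' : cs.length v' = n := by unfold IsGood at hv hv'; rw [he] at hv; omega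
      rcases Nat.eq_zero_or_pos n with h0 | h0
      · rw [cs.length_eq_zero_iff.1 (hn.trans h0), cs.length_eq_zero_iff.1 (hn'.trans h0)]
      -- each reduced decomposition can be normalized with respect to a larger parabolic subgroup
      have red : ∀ w, IsGood cs θ w → cs.length w = n → ∃ s ∈ gens cs, ∃ u, w = u * s ∧
          IsGood cs θ u ∧ cs.length w = cs.length u + 1 := by
        intro w hw hwn
        obtain ⟨i, hi⟩ := cs.exists_rightDescent_of_ne_one (w := w)
          (by rintro rfl; rw [cs.length_one] at hwn; omega)
        have hs : cs.simple i ∈ gens cs := ⟨i, rfl⟩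
        have hlt : cs.length (w * cs.simple i) < cs.length w := hi
        have hl : cs.length w = cs.length (w * cs.simple i) + 1 := by
          have := length_mul_gen hs w; omega
        refine ⟨_, hs, w * cs.simple i, (gen_mul_cancel_right hs w).symm, ?_, hl⟩
        exact hθ.isGood_of_mul_gen hs (by rwa [gen_mul_cancel_right hs])
          (by rwa [gen_mul_cancel_right hs])
      have down : ∀ s ∈ gens cs, ∀ u, IsGood cs θ u → IsGood cs θ (u * s) →
          cs.length (u * s) = cs.length u + 1 → cs.length (u * s) = n →
          ∀ J ⊆ gens cs, s ∈ J → ∃ z ∈ twistedIdentities θ,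
          (∀ k ∈ J, cs.length z < cs.length (z * k)) ∧ ∃ p ∈ Subgroup.closure J, p ≠ 1 ∧
          twistElt θ (u * s) = θ p⁻¹ * z * p ∧
          cs.length (twistElt θ (u * s)) = cs.length z + 2 * cs.length p ∧
          ∀ u0, IsGood cs θ u0 → twistElt θ u0 = z →
            heckeBasis cs q (u * s) ψ = heckeBasis cs q p (heckeBasis cs q u0 ψ) := by
        intro s hs u hu hus hl hln J hJ hsJ
        obtain ⟨z, hz, hzJ, p, hp, he, hlp⟩ := hθ.exists_descent hJ (twistElt_mem (θ := θ) u)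
        have e : twistElt θ (u * s) = θ (p * s)⁻¹ * z * (p * s) := by
          rw [twistElt_mul_gen hs, he, mul_inv_rev, gen_inv hs, map_mul]; simp only [mul_assoc]
        have h1 := hθ.length_twist_le z (p * s)
        rw [← e] at h1
        have h2 := length_mul_gen hs p
        have hps : cs.length (p * s) = cs.length p + 1 := by
          unfold IsGood at hu hus; omega
        refine ⟨z, hz, hzJ, p * s, mul_mem hp (Subgroup.subset_closure hsJ), ?_, e, ?_, ?_⟩
        · intro h; rw [h, cs.length_one] at hps; omega
        · unfold IsGood at hu hus; omega
        · rintro u0 hu0 rfl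
          obtain ⟨h3, h4⟩ := hθ.isGood_mul (p := p) hu0 (by rw [twistElt_mul, ← he, hlp])
          rw [heckeBasis_mul_gen ψ hs (by omega),
            (ih (cs.length u) (by omega)).1 u (u0 * p) hu h3 rfl (by rw [twistElt_mul, he]),
            heckeBasis_mul_gen _ hs (by omega), heckeBasis_mul ψ h4]
      obtain ⟨s, hs, u, rfl, hu, hl⟩ := red v hv hn
      obtain ⟨t, ht, u', rfl, hu', hl'⟩ := red v' hv' hn'
      have hJ : ({s, t} : Set W) ⊆ gens cs := by rintro x (rfl | rfl) <;> assumption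
      obtain ⟨z, hz, hzJ, p, hp, hp1, hx, hlx, hΨ⟩ :=
        down s hs u hu hv hl hn {s, t} hJ (by simp)
      obtain ⟨z', hz', hzJ', p', hp', hp1', hx', hlx', hΨ'⟩ :=
        down t ht u' hu' hv' hl' hn' {s, t} hJ (by simp)
      have hg : θ (p' * p⁻¹) * z = z' * (p' * p⁻¹) := by
        have h1 : θ p⁻¹ * z * p = θ p'⁻¹ * z' * p' := by rw [← hx, ← hx', he]
        have := congrArg (fun x => θ p' * x * p⁻¹) h1
        simpa [mul_assoc] using this
      obtain ⟨rfl, hgK⟩ := hθ.eq_of_map_mul_eq hJ hz hzJ hz' hzJ'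
        (mul_mem hp' (inv_mem hp)) (mul_mem hp' (inv_mem hp)) hg
      obtain ⟨u0, hu0, hu0z⟩ := hθ.exists_isGood hz
      rw [hΨ u0 hu0 hu0z, hΨ' u0 hu0 hu0z]
      have hlpp : cs.length p = cs.length p' := by rw [← he] at hlx'; omega
      have hpos : 0 < cs.length p := by
        rw [Nat.pos_iff_ne_zero, Ne, cs.length_eq_zero_iff]; exact hp1
      by_cases hKK : s ∈ stuckGens θ z {s, t} ∧ t ∈ stuckGens θ z {s, t} ∧ s ≠ t
      · obtain ⟨hsK, htK, hst⟩ := hKK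
        have hφs := (hθ.conjTheta_mem_stuckGens hz hsK).1
        have hφt := (hθ.conjTheta_mem_stuckGens hz htK).1
        have hinj : conjTheta θ z s ≠ conjTheta θ z t := fun h => hst (by
          rw [← hθ.conjTheta_conjTheta hz s, h, hθ.conjTheta_conjTheta hz])
        rcases hφs with h1 | h1
        · have h2 : conjTheta θ z t = t := by
            rcases hφt with h2 | h2
            · exact absurd (h1.trans h2.symm) hinj
            · exact h2
          have h3 : conjTheta θ z p = p := by
            refine MonoidHom.eqOn_closure (f := conjTheta θ z) (g := MonoidHom.id W) ?_ hp
            rintro x (rfl | rfl) <;> assumption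
          exact absurd h3 (conjTheta_ne_self hp1 hx hlx)
        · replace h1 : conjTheta θ z s = t := h1
          have h2 : conjTheta θ z t = s := by rw [← h1, hθ.conjTheta_conjTheta hz]
          have h2' := conjTheta_eq_iff.1 h2
          have hzs := hzJ s (by simp)
          have hc := hθ.commute_of_stuck hcomm hz hs ht h2' hzs
          have hfour : ∀ r ∈ Subgroup.closure ({s, t} : Set W), r ≠ 1 →
              twistElt θ (u * s) = θ r⁻¹ * z * r →
              cs.length (twistElt θ (u * s)) = cs.length z + 2 * cs.length r → r = s ∨ r = t := by
            intro r hr hr1 hxr hlr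
            rcases mem_four_of_mem_closure (gen_mul_self hs) (gen_mul_self ht) hc subset_rfl hr
              with h | h | h | h
            · exact absurd h hr1
            · exact Or.inl h
            · exact Or.inr h
            · refine absurd ?_ (conjTheta_ne_self hr1 hxr hlr)
              rw [h, map_mul, h1, h2, hc.eq]
          have hSX := ((ih (cs.length u0) (by unfold IsGood at hu0 hv; rw [hu0z] at hu0; omega)).2
            u0 hu0 rfl s hs t ht (by rw [hu0z, h2']) (by rwa [hu0z])).1
          rcases hfour p hp hp1 hx hlx with rfl | rfl <;>
            rcases hfour p' hp' hp1' (by rw [he, hx']) (by rw [he, hlx']) with rfl | rfl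
          · rfl
          · rw [heckeBasis_gen _ hs, heckeBasis_gen _ ht, hSX]
          · rw [heckeBasis_gen _ hs, heckeBasis_gen _ ht, hSX]
          · rfl
      · obtain ⟨k, hk, hkK⟩ : ∃ k ∈ gens cs, stuckGens θ z {s, t} ⊆ {k} := by
          by_cases h1 : s ∈ stuckGens θ z {s, t}
          · refine ⟨s, hs, fun x hx => ?_⟩
            rcases hx.1 with rfl | rfl
            · rfl
            · by_contra h2
              exact hKK ⟨h1, hx, fun h => h2 h.symm⟩
          · refine ⟨t, ht, fun x hx => ?_⟩
            rcases hx.1 with rfl | rfl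
            · exact absurd hx h1
            · rfl
        rcases eq_one_or_eq_of_mem_closure (gen_mul_self hk) hkK hgK with h1 | h1
        · rw [mul_inv_eq_one.1 h1]
        · have h2 := length_gen_mul hk p
          rw [← h1, inv_mul_cancel_right] at h2
          omega
    refine ⟨hU, fun v hv hn s hs t ht hst hlt => ?_⟩
    by_cases hy1 : twistElt θ v = 1
    · have hv1 : v = 1 := by
        unfold IsGood at hv
        rw [hy1, cs.length_one] at hv
        exact cs.length_eq_zero_iff.1 (by omega)
      rw [hy1, mul_one, one_mul] at hst
      rw [hv1, heckeBasis_one]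
      refine ⟨by rw [← hst, hψ1 t ht], ?_⟩
      rintro rfl
      exact hψ2 s hs hst
    · obtain ⟨z, hz, p, hp1, hx, hl, k, hk, k', hk', h1, h2, h3, h4, h5, h6, -⟩ :=
        hθ.exists_stuck_conj hcomm (twistElt_mem v) hy1 hs ht hst hlt
      obtain ⟨u0, hu0, rfl⟩ := hθ.exists_isGood hz
      obtain ⟨h7, h8⟩ := hθ.isGood_mul (p := p) hu0 (by rw [twistElt_mul, ← hx, hl])
      have hpos : 0 < cs.length p := by
        rw [Nat.pos_iff_ne_zero, Ne, cs.length_eq_zero_iff]; exact hp1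
      have hR : ∀ s ∈ gens cs, ∀ k ∈ gens cs, p * s = k * p →
          cs.length (p * s) = cs.length p + 1 → heckeR cs q s (heckeBasis cs q v ψ) =
            heckeBasis cs q p (heckeR cs q k (heckeBasis cs q u0 ψ)) := by
        intro s hs k hk e hl
        rw [hU v (u0 * p) hv h7 hn (by rw [twistElt_mul, hx]), heckeBasis_mul ψ h8,
          ← heckeBasis_mul_gen _ hs (by omega), e, heckeBasis_gen_mul _ hk (by rw [← e]; omega)]
      obtain ⟨h9, h10⟩ := (ih (cs.length u0) (by unfold IsGood at hu0 hv; omega)).2 u0 hu0 rfl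
        k hk k' hk' h5 h6
      refine ⟨by rw [hR s hs k hk h1 h3, hR t ht k' hk' h2 h4, h9], ?_⟩
      rintro rfl
      have hkk : k = k' := mul_right_cancel (h1.symm.trans h2)
      rw [hR s hs k hk h1 h3, h10 hkk, heckeBasis_smul, ← heckeBasis_mul ψ h8,
        hU v (u0 * p) hv h7 hn (by rw [twistElt_mul, hx])]

end Spherical

/-! ### The fixed point subgroup -/

section Fixed

variable {cs : CoxeterSystem M W} {θ : W ≃* W} {s t f w : W}

/-- The longest element of the parabolic subgroup generated by the commuting pair `s, θ s`. -/
noncomputable def fixGen (θ : W ≃* W) (s : W) : W := if θ s = s then s else s * θ s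

theorem fixGen_of_eq (h : θ s = s) : fixGen θ s = s := if_pos h

theorem fixGen_of_ne (h : θ s ≠ s) : fixGen θ s = s * θ s := if_neg h

theorem length_mul_of_ne (hs : s ∈ gens cs) (ht : t ∈ gens cs) (h : s ≠ t) :
    cs.length (s * t) = 2 := by
  have h1 := length_mul_gen ht s
  rw [length_gen hs] at h1
  rcases h1 with h1 | h1
  · exact h1
  · have h0 : s * t = 1 := cs.length_eq_zero_iff.1 (by omega)
    rw [mul_eq_one_iff_eq_inv, gen_inv ht] at h0
    exact absurd h0 h

theorem length_mul_mul_gen_lt_iff (hs : s ∈ gens cs) (ht : t ∈ gens cs) (h : s ≠ t)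
    (hc : Commute s t) (w : W) :
    cs.length (w * s * t) < cs.length (w * s) ↔ cs.length (w * t) < cs.length w := by
  have e : s * t * s⁻¹ = t := by rw [hc.eq, mul_inv_cancel_right]
  rw [length_mul_mul_lt_iff cs (isReflection_of_mem_gens ht), e, length_mul_of_ne hs ht h,
    length_gen hs]
  tauto

theorem mem_closure_pair (hs : s ∈ gens cs) (hθs : θ s ∈ gens cs) (hc : Commute s (θ s)) {h : W}
    (hh : h ∈ Subgroup.closure ({s, θ s} : Set W)) :
    h = 1 ∨ h = s ∨ h = θ s ∨ h = s * θ s :=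
  mem_four_of_mem_closure (gen_mul_self hs) (gen_mul_self hθs) hc subset_rfl hh

namespace IsDiagramInvolution

variable (hθ : IsDiagramInvolution cs θ)
include hθ

theorem length_mul_map (hf : θ f = f) (s : W) : cs.length (f * θ s) = cs.length (f * s) := by
  rw [← hθ.length_map (f * s), map_mul, hf]

variable (hcomm : ∀ s ∈ gens cs, Commute s (θ s))
include hcomm

theorem map_fixGen (hs : s ∈ gens cs) : θ (fixGen θ s) = fixGen θ s := by
  unfold fixGen
  split_ifs with h
  · exact h
  · rw [map_mul, hθ.apply_apply, (hcomm s hs).eq]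

theorem fixGen_mul_self (hs : s ∈ gens cs) : fixGen θ s * fixGen θ s = 1 := by
  unfold fixGen
  split_ifs with h
  · exact gen_mul_self hs
  · rw [(hcomm s hs).symm.mul_mul_mul_comm, gen_mul_self hs,
      gen_mul_self (hθ.map_gens s hs), one_mul]

theorem canonicalGens_eq : canonicalGens cs θ = fixGen θ '' gens cs := by
  have hlen : ∀ s ∈ gens cs, θ s ≠ s → cs.length (s * θ s) = 2 := fun s hs h =>
    length_mul_of_ne hs (hθ.map_gens s hs) (Ne.symm h)
  have hmax : ∀ s ∈ gens cs, ∀ x ∈ Subgroup.closure ({s, θ s} : Set W),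
      cs.length x ≤ cs.length (fixGen θ s) ∧
        (cs.length (fixGen θ s) ≤ cs.length x → x = fixGen θ s) := by
    intro s hs x hx
    have h1 := mem_closure_pair hs (hθ.map_gens s hs) (hcomm s hs) hx
    by_cases h : θ s = s
    · rw [fixGen_of_eq h, length_gen hs]
      rw [h, gen_mul_self hs] at h1
      have h2 : x = 1 ∨ x = s := by tauto
      rcases h2 with rfl | rfl
      · simp
      · simp [length_gen hs]
    · rw [fixGen_of_ne h, hlen s hs h]
      rcases h1 with rfl | rfl | rfl | rfl
      · simp
      · simp [length_gen hs]
      · simp [length_gen (hθ.map_gens s hs)]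
      · simp [hlen s hs h]
  have hmem : ∀ s ∈ gens cs, fixGen θ s ∈ Subgroup.closure ({s, θ s} : Set W) := by
    intro s _
    have h1 : s ∈ Subgroup.closure ({s, θ s} : Set W) := Subgroup.subset_closure (by simp)
    have h2 : θ s ∈ Subgroup.closure ({s, θ s} : Set W) := Subgroup.subset_closure (by simp)
    unfold fixGen
    split_ifs
    · exact h1
    · exact mul_mem h1 h2
  ext x
  constructor
  · rintro ⟨i, -, hx, hxmax⟩
    have hs : cs.simple i ∈ gens cs := ⟨i, rfl⟩
    exact ⟨_, hs, ((hmax _ hs x hx).2 (hxmax _ (hmem _ hs))).symm⟩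
  · rintro ⟨_, ⟨i, rfl⟩, rfl⟩
    have hs : cs.simple i ∈ gens cs := ⟨i, rfl⟩
    refine ⟨i, ?_, hmem _ hs, fun y hy => (hmax _ hs y hy).1⟩
    refine Set.Finite.subset (s := {1, cs.simple i, θ (cs.simple i),
      cs.simple i * θ (cs.simple i)}) (by simp) fun x hx => ?_
    exact mem_closure_pair hs (hθ.map_gens _ hs) (hcomm _ hs) hx

theorem map_prod_fixGens {l : List W} (hl : ∀ x ∈ l, x ∈ canonicalGens cs θ) :
    θ l.prod = l.prod := by
  induction l with
  | nil => simp
  | cons g l ih =>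
    obtain ⟨s, hs, hg⟩ := hθ.canonicalGens_eq hcomm ▸ hl g (by simp)
    rw [List.prod_cons, map_mul, ih fun x hx => hl x (by simp [hx]), ← hg,
      hθ.map_fixGen hcomm hs]

theorem fixGen_mem (hs : s ∈ gens cs) : fixGen θ s ∈ canonicalGens cs θ := by
  rw [hθ.canonicalGens_eq hcomm]; exact ⟨s, hs, rfl⟩

/-- The exchange condition for `Fix(θ)`. -/
theorem exists_exchange {l : List W} (hl : ∀ x ∈ l, x ∈ canonicalGens cs θ) (hs : s ∈ gens cs)
    (h : cs.length (l.prod * s) < cs.length l.prod) :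
    ∃ l' : List W, (∀ x ∈ l', x ∈ canonicalGens cs θ) ∧ l'.length + 1 = l.length ∧
      l'.prod = l.prod * fixGen θ s := by
  induction l with
  | nil => simp at h
  | cons g l ih =>
    have hl' : ∀ x ∈ l, x ∈ canonicalGens cs θ := fun x hx => hl x (by simp [hx])
    have hg := hl g (by simp)
    by_cases h1 : cs.length (l.prod * s) < cs.length l.prod
    · obtain ⟨l', h2, h3, h4⟩ := ih hl' h1
      refine ⟨g :: l', ?_, by simp [h3], by simp [h4, mul_assoc]⟩
      simp only [List.mem_cons, forall_eq_or_imp]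
      exact ⟨hg, h2⟩
    refine ⟨l, hl', by simp, ?_⟩
    have hQ := hθ.map_prod_fixGens hcomm hl'
    set Q := l.prod with hQdef
    rw [List.prod_cons, length_mul_mul_lt_iff cs (isReflection_of_mem_gens hs)] at h
    have hr : cs.length (g * (Q * s * Q⁻¹)) < cs.length g := by
      by_contra h2; exact h (iff_of_false h1 h2)
    have hrr : cs.IsReflection (Q * s * Q⁻¹) := (isReflection_of_mem_gens hs).conj Q
    rw [List.prod_cons, ← hQdef]
    suffices hconj : Q * fixGen θ s * Q⁻¹ = g by
      have hgg : Q * fixGen θ s = g * Q := by rw [← hconj]; simp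
      rw [mul_assoc, hgg, ← mul_assoc, ← hconj]
      have := hθ.fixGen_mul_self hcomm hs
      have e : Q * fixGen θ s * Q⁻¹ * (Q * fixGen θ s * Q⁻¹) * Q =
          Q * (fixGen θ s * fixGen θ s) := by simp [mul_assoc]
      rw [e, this, mul_one]
    rw [hθ.canonicalGens_eq hcomm] at hg
    obtain ⟨a, ha, rfl⟩ := hg
    have ha' := hθ.map_gens a ha
    have hθr : θ (Q * s * Q⁻¹) = Q * θ s * Q⁻¹ := by rw [map_mul, map_mul, map_inv, hQ]
    have hJ : ({a, θ a} : Set W) ⊆ gens cs := by rintro x (rfl | rfl) <;> assumption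
    have hfa : fixGen θ a ∈ Subgroup.closure ({a, θ a} : Set W) := by
      have h1 : a ∈ Subgroup.closure ({a, θ a} : Set W) := Subgroup.subset_closure (by simp)
      have h2 : θ a ∈ Subgroup.closure ({a, θ a} : Set W) := Subgroup.subset_closure (by simp)
      unfold fixGen
      split_ifs
      · exact h1
      · exact mul_mem h1 h2
    have hrc := reflection_mem_closure hJ hfa hrr hr
    have hcases : Q * s * Q⁻¹ = a ∨ Q * s * Q⁻¹ = θ a := by
      have hodd := hrr.odd_length
      rcases mem_closure_pair ha ha' (hcomm a ha) hrc with h2 | h2 | h2 | h2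
      · rw [h2] at hodd; simp at hodd
      · exact Or.inl h2
      · exact Or.inr h2
      · have h3 := length_mul_gen ha' a
        rw [← h2, length_gen ha] at h3
        obtain ⟨m, hm⟩ := hodd
        omega
    by_cases hfix : θ a = a
    · have h2 : Q * s * Q⁻¹ = a := by rcases hcases with h2 | h2 <;> simp [h2, hfix]
      have h3 : θ s = s := by
        rw [h2, hfix] at hθr
        rw [← h2] at hθr
        simpa using hθr.symm
      rw [fixGen_of_eq h3, fixGen_of_eq hfix, h2]
    · have h3 : θ s ≠ s := by
        intro h3
        rw [h3] at hθr
        rcases hcases with h4 | h4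
        · rw [h4] at hθr; exact hfix hθr
        · rw [h4, hθ.apply_apply] at hθr; exact hfix hθr.symm
      rw [fixGen_of_ne h3, fixGen_of_ne hfix]
      have e : Q * (s * θ s) * Q⁻¹ = (Q * s * Q⁻¹) * (Q * θ s * Q⁻¹) := by simp [mul_assoc]
      rw [e, ← hθr]
      rcases hcases with h4 | h4
      · rw [h4]
      · rw [h4, hθ.apply_apply, (hcomm a ha).eq]

theorem length_mul_fixGen_lt (hs : s ∈ gens cs) (hf : θ f = f)
    (h : cs.length (f * s) < cs.length f) : cs.length (f * fixGen θ s) < cs.length f := by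
  by_cases hfix : θ s = s
  · rwa [fixGen_of_eq hfix]
  · rw [fixGen_of_ne hfix, ← mul_assoc]
    have := (length_mul_mul_gen_lt_iff hs (hθ.map_gens s hs) (Ne.symm hfix) (hcomm s hs) f).2
      (by rwa [hθ.length_mul_map hf])
    omega

theorem map_mul_fixGen (hs : s ∈ gens cs) (hf : θ f = f) :
    θ (f * fixGen θ s) = f * fixGen θ s := by
  rw [map_mul, hf, hθ.map_fixGen hcomm hs]

theorem exists_fixGens_prod (hf : θ f = f) :
    ∃ l : List W, (∀ x ∈ l, x ∈ canonicalGens cs θ) ∧ l.prod = f := by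
  induction hn : cs.length f using Nat.strong_induction_on generalizing f with
  | _ n ih =>
    by_cases h1 : f = 1
    · exact ⟨[], by simp, by simp [h1]⟩
    · obtain ⟨i, hi⟩ := cs.exists_rightDescent_of_ne_one h1
      have hs : cs.simple i ∈ gens cs := ⟨i, rfl⟩
      obtain ⟨l, hl, hlf⟩ := ih _ (hn ▸ hθ.length_mul_fixGen_lt hcomm hs hf hi)
        (hθ.map_mul_fixGen hcomm hs hf) rfl
      refine ⟨l ++ [fixGen θ (cs.simple i)], ?_, ?_⟩
      · intro x hx
        rcases List.mem_append.1 hx with hx | hx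
        · exact hl x hx
        · rw [List.mem_singleton.1 hx]; exact hθ.fixGen_mem hcomm hs
      · rw [List.prod_append, hlf, List.prod_singleton, mul_assoc, hθ.fixGen_mul_self hcomm hs,
          mul_one]

theorem exists_fixLength_word (hf : θ f = f) :
    ∃ l : List W, l.length = fixLength cs θ f ∧ (∀ x ∈ l, x ∈ canonicalGens cs θ) ∧
      l.prod = f := by
  obtain ⟨l, hl, h⟩ := hθ.exists_fixGens_prod hcomm hf
  exact Nat.sInf_mem (s := {n | ∃ l : List W, l.length = n ∧
    (∀ x ∈ l, x ∈ canonicalGens cs θ) ∧ l.prod = f}) ⟨_, l, rfl, hl, h⟩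

theorem fixLength_mul_fixGen_le (hs : s ∈ gens cs) (hf : θ f = f) :
    fixLength cs θ (f * fixGen θ s) ≤ fixLength cs θ f + 1 := by
  obtain ⟨l, hl, hlg, hlf⟩ := hθ.exists_fixLength_word hcomm hf
  refine Nat.sInf_le ⟨l ++ [fixGen θ s], by simp [hl], ?_, by simp [hlf]⟩
  intro x hx
  rcases List.mem_append.1 hx with hx | hx
  · exact hlg x hx
  · rw [List.mem_singleton.1 hx]; exact hθ.fixGen_mem hcomm hs

theorem fixLength_of_descent (hs : s ∈ gens cs) (hf : θ f = f)
    (h : cs.length (f * s) < cs.length f) :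
    fixLength cs θ (f * fixGen θ s) + 1 = fixLength cs θ f := by
  obtain ⟨l, hl, hlg, rfl⟩ := hθ.exists_fixLength_word hcomm hf
  obtain ⟨l', h1, h2, h3⟩ := hθ.exists_exchange hcomm hlg hs h
  have h4 : fixLength cs θ (l.prod * fixGen θ s) ≤ l'.length := Nat.sInf_le ⟨l', rfl, h1, h3⟩
  have h5 := hθ.fixLength_mul_fixGen_le hcomm hs (hθ.map_mul_fixGen hcomm hs hf)
  rw [mul_assoc, hθ.fixGen_mul_self hcomm hs, mul_one] at h5
  omega

theorem fixLength_of_ascent (hs : s ∈ gens cs) (hf : θ f = f)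
    (h : cs.length f < cs.length (f * s)) :
    fixLength cs θ (f * fixGen θ s) = fixLength cs θ f + 1 := by
  have h1 : cs.length (f * fixGen θ s * s) < cs.length (f * fixGen θ s) := by
    by_cases hfix : θ s = s
    · rwa [fixGen_of_eq hfix, gen_mul_cancel_right hs]
    · have h2 := length_mul_mul_gen_lt_iff hs (hθ.map_gens s hs) (Ne.symm hfix) (hcomm s hs)
        (f * θ s)
      have h3 := length_mul_mul_gen_lt_iff hs (hθ.map_gens s hs) (Ne.symm hfix) (hcomm s hs) f
      have h4 := length_mul_gen (hθ.map_gens s hs) (f * s)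
      have h6 := hθ.length_mul_map hf s
      rw [fixGen_of_ne hfix, (hcomm s hs).eq, ← mul_assoc, gen_mul_cancel_right hs]
      rw [mul_assoc f, (hcomm s hs).eq, ← mul_assoc] at h3 h4
      omega
  have h2 := hθ.fixLength_of_descent hcomm hs (hθ.map_mul_fixGen hcomm hs hf) h1
  rw [mul_assoc, hθ.fixGen_mul_self hcomm hs, mul_one] at h2
  exact h2.symm

end IsDiagramInvolution

/-- The generating function of the word length on `Fix(θ)`, extended by zero. -/
noncomputable def fixWeight (cs : CoxeterSystem M W) (θ : W ≃* W) {A : Type*} [CommRing A] (q : A)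
    (w : W) : A :=
  if θ w = w then q ^ fixLength cs θ w else 0

variable {A : Type*} [CommRing A] {q : A}

theorem fixWeight_of_eq (h : θ w = w) : fixWeight cs θ q w = q ^ fixLength cs θ w := if_pos h

theorem fixWeight_of_ne (h : θ w ≠ w) : fixWeight cs θ q w = 0 := if_neg h

namespace IsDiagramInvolution

variable (hθ : IsDiagramInvolution cs θ) (hcomm : ∀ s ∈ gens cs, Commute s (θ s))
include hθ hcomm

theorem heckeR_fixWeight_of_eq (hs : s ∈ gens cs) (hfix : θ s = s) :
    heckeR cs q s (fixWeight cs θ q) = q • fixWeight cs θ q := by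
  ext w
  have hws : θ (w * s) = w * s ↔ θ w = w := by rw [map_mul, hfix, mul_left_inj]
  rw [Pi.smul_apply, smul_eq_mul]
  rcases lt_or_ge (cs.length w) (cs.length (w * s)) with h | h
  · rw [heckeR_of_lt _ h]
    by_cases hw : θ w = w
    · have := hθ.fixLength_of_ascent hcomm hs hw h
      rw [fixGen_of_eq hfix] at this
      rw [fixWeight_of_eq hw, fixWeight_of_eq (hws.2 hw), this, pow_succ']
    · rw [fixWeight_of_ne hw, fixWeight_of_ne (mt hws.1 hw), mul_zero]
  · rw [heckeR_of_le _ h]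
    by_cases hw : θ w = w
    · have := hθ.fixLength_of_descent hcomm hs hw (by have := length_mul_gen hs w; omega)
      rw [fixGen_of_eq hfix] at this
      rw [fixWeight_of_eq hw, fixWeight_of_eq (hws.2 hw), ← this, pow_succ']
      ring
    · rw [fixWeight_of_ne hw, fixWeight_of_ne (mt hws.1 hw)]; ring

theorem heckeR_fixWeight (hs : s ∈ gens cs) :
    heckeR cs q s (fixWeight cs θ q) = heckeR cs q (θ s) (fixWeight cs θ q) := by
  by_cases hfix : θ s = s
  · rw [hfix]
  have hc := hcomm s hs
  have hs' := hθ.map_gens s hs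
  have hw1 : ∀ w, θ (w * s) = w * s ↔ θ w = w * s * θ s := by
    intro w
    rw [map_mul, ← mul_left_inj (θ s), gen_mul_cancel_right hs']
  have hw2 : ∀ w, θ (w * θ s) = w * θ s ↔ θ w = w * s * θ s := by
    intro w
    rw [map_mul, hθ.apply_apply, ← mul_left_inj s, gen_mul_cancel_right hs, mul_assoc w,
      mul_assoc w, hc.eq]
  have hup : ∀ s ∈ gens cs, θ s ≠ s → ∀ f, θ f = f → cs.length f < cs.length (f * s) →
      fixWeight cs θ q (f * s * θ s) = q * fixWeight cs θ q f := by
    intro s hs hfix f hf h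
    have h1 := hθ.fixLength_of_ascent hcomm hs hf h
    have h2 := hθ.map_mul_fixGen hcomm hs hf
    rw [fixGen_of_ne hfix, ← mul_assoc] at h1 h2
    rw [fixWeight_of_eq h2, h1, fixWeight_of_eq hf, pow_succ']
  have hone : ∀ s ∈ gens cs, θ s ≠ s → ∀ w, cs.length w < cs.length (w * s) →
      cs.length (w * θ s) ≤ cs.length w →
      heckeR cs q s (fixWeight cs θ q) w = heckeR cs q (θ s) (fixWeight cs θ q) w := by
    intro s hs hfix w h1 h2
    have hs' := hθ.map_gens s hs
    rw [heckeR_of_lt _ h1, heckeR_of_le _ h2]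
    have hw : θ w ≠ w := by
      intro hw
      have := hθ.length_mul_map hw s
      omega
    rw [fixWeight_of_ne hw, mul_zero, add_zero]
    by_cases hf : θ (w * θ s) = w * θ s
    · have h3 := hup (θ s) hs' (fun h => hfix (by rw [hθ.apply_apply] at h; exact h.symm))
        (w * θ s) hf (by rw [gen_mul_cancel_right hs']; have := length_mul_gen hs' w; omega)
      rwa [gen_mul_cancel_right hs', hθ.apply_apply] at h3
    · have hf2 : θ (w * s) ≠ w * s := by
        intro h
        apply hf
        have h4 : w * θ s = w * s * fixGen θ s := by
          rw [fixGen_of_ne hfix, ← mul_assoc, gen_mul_cancel_right hs]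
        rw [h4, hθ.map_mul_fixGen hcomm hs h]
      rw [fixWeight_of_ne hf, fixWeight_of_ne hf2, mul_zero]
  ext w
  rcases lt_or_ge (cs.length w) (cs.length (w * s)) with h1 | h1 <;>
    rcases lt_or_ge (cs.length w) (cs.length (w * θ s)) with h2 | h2
  · have hne : θ w ≠ w * s * θ s := by
      intro h
      have h3 := hθ.length_map w
      have h4 := length_mul_mul_gen_lt_iff hs hs' (Ne.symm hfix) hc w
      have h5 := length_mul_gen hs' (w * s)
      rw [h] at h3
      omega
    rw [heckeR_of_lt _ h1, heckeR_of_lt _ h2, fixWeight_of_ne (mt (hw1 w).1 hne),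
      fixWeight_of_ne (mt (hw2 w).1 hne)]
  · exact hone s hs hfix w h1 h2
  · have := hone (θ s) hs' (fun h => hfix (by rw [hθ.apply_apply] at h; exact h.symm)) w h2
      (by rwa [hθ.apply_apply])
    rw [hθ.apply_apply] at this
    exact this.symm
  · have hne : θ w ≠ w * s * θ s := by
      intro h
      have h3 := hθ.length_map w
      have h4 := length_mul_mul_gen_lt_iff hs hs' (Ne.symm hfix) hc w
      have h6 := length_mul_gen hs' w
      rw [h] at h3
      omega
    rw [heckeR_of_le _ h1, heckeR_of_le _ h2, fixWeight_of_ne (mt (hw1 w).1 hne),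
      fixWeight_of_ne (mt (hw2 w).1 hne)]

end IsDiagramInvolution

end Fixed

/-! ### Factorization of the Poincaré series -/

section Factorization

variable {cs : CoxeterSystem M W} {θ : W ≃* W} {s : W} {A : Type*} [CommRing A] {q : A}

/-- The index representation of the Hecke algebra is determined by its value at `1`. -/
theorem apply_eq_of_heckeR_eq {Ψ : W → A} (h : ∀ s ∈ gens cs, heckeR cs q s Ψ = q • Ψ) (w : W) :
    Ψ w = q ^ cs.length w * Ψ 1 := by
  induction hn : cs.length w using Nat.strong_induction_on generalizing w with
  | _ n ih =>
    by_cases h1 : w = 1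
    · rw [h1, ← hn, h1, cs.length_one, pow_zero, one_mul]
    · obtain ⟨i, hi⟩ := cs.exists_rightDescent_of_ne_one h1
      have hs : cs.simple i ∈ gens cs := ⟨i, rfl⟩
      replace hi : cs.length (w * cs.simple i) < cs.length w := hi
      have h2 := congrFun (h _ hs) (w * cs.simple i)
      rw [heckeR_of_lt _ (by rwa [gen_mul_cancel_right hs]), gen_mul_cancel_right hs, Pi.smul_apply,
        smul_eq_mul, ih (cs.length (w * cs.simple i)) (by omega) (w * cs.simple i) rfl] at h2
      have h3 : n = cs.length (w * cs.simple i) + 1 := by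
        have := length_mul_gen hs w; omega
      rw [h2, h3, pow_succ', mul_assoc]

theorem fixLength_one : fixLength cs θ (1 : W) = 0 :=
  Nat.sInf_eq_zero.2 (Or.inl ⟨[], rfl, by simp, rfl⟩)

theorem IsDiagramInvolution.sum_pow_length [Fintype W] (hθ : IsDiagramInvolution cs θ)
    (hcomm : ∀ s ∈ gens cs, Commute s (θ s)) :
    ∑ w : W, q ^ cs.length w =
      (∑ w : W, if w ∈ twistedIdentities θ then q ^ twistRank cs θ w else 0) *
        ∑ w : W, if θ w = w then q ^ fixLength cs θ w else 0 := by
  choose v hv hvx using fun x : twistedIdentities θ => hθ.exists_isGood x.2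
  set F : twistedIdentities θ → W → A := fun x => heckeBasis cs q (v x) (fixWeight cs θ q) with hF
  have hU := fun n => hθ.heckeBasis_spherical hcomm (q := q) (ψ := fixWeight cs θ q)
    (fun s hs => hθ.heckeR_fixWeight hcomm hs)
    (fun s hs h => hθ.heckeR_fixWeight_of_eq hcomm hs h) n
  have hup : ∀ (x y : twistedIdentities θ) (s : W), s ∈ gens cs → (y : W) = θ s * x * s →
      θ s * (x : W) ≠ x * s → cs.length (x : W) < cs.length (x * s) →
      heckeR cs q s (F x) = F y := by
    intro x y s hs hy hne hlt
    have hl := hθ.length_twist_of_ascent x.2 hs hlt hne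
    obtain ⟨h1, h2⟩ := hθ.isGood_mul_gen hs (hv x) (by rwa [hvx])
    rw [hF]
    simp only
    rw [← heckeBasis_mul_gen _ hs (by omega)]
    exact (hU _).1 _ _ h1 (hv y) rfl (by rw [twistElt_mul_gen hs, hvx, hvx, hy])
  have hinv : ∀ s ∈ gens cs, heckeR cs q s (∑ x, F x) = q • ∑ x, F x := by
    intro s hs
    rw [← sub_eq_zero, map_sum, Finset.smul_sum, ← Finset.sum_sub_distrib]
    have hself : ∀ x : W, θ s * (θ s * x * s) * s = x := by
      intro x
      rw [mul_assoc (θ s) x s, gen_mul_cancel_left (hθ.map_gens s hs), gen_mul_cancel_right hs]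
    have hstuck : ∀ x : W, θ s * x * s = x ↔ θ s * x = x * s := by
      intro x
      rw [← mul_left_inj s, gen_mul_cancel_right hs]
    have hpair : ∀ x y : twistedIdentities θ, (y : W) = θ s * x * s →
        θ s * (x : W) ≠ x * s → cs.length (x : W) < cs.length (x * s) →
        heckeR cs q s (F x) - q • F x + (heckeR cs q s (F y) - q • F y) = 0 := by
      intro x y hy hne hlt
      rw [← hup x y s hs hy hne hlt, heckeR_heckeR _ hs, sub_smul, one_smul]
      abel
    refine Finset.sum_involution (fun x _ => ⟨θ s * x * s, twist_gen_mem x.2 hs⟩) ?_ ?_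
      (fun _ _ => Finset.mem_univ _) (fun x _ => Subtype.ext (hself x))
    · intro x _
      by_cases hne : θ s * (x : W) = x * s
      · have h1 := ((hU _).2 (v x) (hv x) rfl s hs s hs (by rw [hvx, hne])
          (by rw [hvx]; exact hθ.lt_of_stuck x.2 hs hne)).2 rfl
        have h2 : (⟨θ s * x * s, twist_gen_mem x.2 hs⟩ : twistedIdentities θ) = x :=
          Subtype.ext ((hstuck x).2 hne)
        rw [h2]
        change heckeR cs q s (F x) = q • F x at h1
        rw [h1]; simp
      · rcases lt_or_ge (cs.length (x : W)) (cs.length (x * s)) with h | h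
        · exact hpair x _ rfl hne h
        · have h1 := length_mul_gen hs (x : W)
          have h2 := hθ.length_twist_of_descent x.2 hs (by omega)
          rw [add_comm]
          refine hpair ⟨θ s * x * s, twist_gen_mem x.2 hs⟩ x (hself x).symm ?_ ?_
          · intro h4
            apply hne
            rw [← hstuck, hself] at h4
            rw [← hstuck]; exact h4.symm
          · simp only
            rw [gen_mul_cancel_right hs, hθ.length_map_gen_mul x.2 hs]
            omega
    · intro x _ hx h
      apply hx
      have hne := (hstuck x).1 (congrArg Subtype.val h)
      have h1 := ((hU _).2 (v x) (hv x) rfl s hs s hs (by rw [hvx, hne])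
        (by rw [hvx]; exact hθ.lt_of_stuck x.2 hs hne)).2 rfl
      exact sub_eq_zero.2 h1
  have hone : (∑ x, F x) 1 = 1 := by
    have h1mem : (1 : W) ∈ twistedIdentities θ := ⟨1, by simp⟩
    rw [Finset.sum_apply, Finset.sum_eq_single ⟨1, h1mem⟩]
    · have h1 : v ⟨1, h1mem⟩ = 1 := by
        have h2 := hv ⟨1, h1mem⟩
        unfold IsGood at h2
        rw [hvx, cs.length_one] at h2
        exact cs.length_eq_zero_iff.1 (by omega)
      simp only [hF]
      rw [h1, heckeBasis_apply_one, inv_one, fixWeight_of_eq (map_one θ), fixLength_one, pow_zero]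
    · intro x _ hx
      simp only [hF]
      rw [heckeBasis_apply_one, fixWeight_of_ne]
      intro h
      apply hx
      apply Subtype.ext
      rw [← hvx x, twistElt, h, inv_mul_cancel]
    · simp
  have hsum : ∑ w, (∑ x, F x) w = ∑ w : W, q ^ cs.length w :=
    Finset.sum_congr rfl fun w _ => by rw [apply_eq_of_heckeR_eq hinv, hone, mul_one]
  rw [← hsum]
  simp only [Finset.sum_apply]
  rw [Finset.sum_comm]
  simp only [hF]
  simp only [sum_heckeBasis]
  rw [← Finset.sum_mul]
  congr 1
  rw [← Finset.sum_filter, Finset.sum_subtype _ (p := fun w => w ∈ twistedIdentities θ) (by simp)]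
  refine Finset.sum_congr rfl fun x _ => ?_
  have h1 := hθ.twistRank_eq x.2
  have h2 := hv x
  unfold IsGood at h2
  rw [hvx] at h2
  congr 1
  omega

end Factorization

section Series

theorem map_mk_card {α : Type*} [Fintype α] (P : α → Prop) (d : α → ℕ) :
    PowerSeries.map (Nat.castRingHom ℤ)
        (PowerSeries.mk fun n => Nat.card {w : α // P w ∧ d w = n}) =
      ∑ w : α, if P w then (PowerSeries.X : PowerSeries ℤ) ^ d w else 0 := by
  ext n
  rw [PowerSeries.coeff_map, PowerSeries.coeff_mk, map_sum, Nat.card_eq_fintype_card,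
    Fintype.card_subtype, Finset.card_filter]
  push_cast
  refine Finset.sum_congr rfl fun w _ => ?_
  by_cases h : P w
  · simp [h, PowerSeries.coeff_X_pow, eq_comm]
  · simp [h]

theorem IsDiagramInvolution.poinW_eq [Finite W] {cs : CoxeterSystem M W} {θ : W ≃* W}
    (hθ : IsDiagramInvolution cs θ) (hcomm : ∀ s ∈ gens cs, Commute s (θ s)) :
    poinW cs = poinIota cs θ * poinFix cs θ := by
  have := Fintype.ofFinite W
  apply PowerSeries.map_injective (Nat.castRingHom ℤ) Nat.cast_injective
  have hW := map_mk_card (fun _ : W => True) cs.length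
  simp only [true_and, if_true] at hW
  rw [map_mul, poinW, poinIota, poinFix, hW, map_mk_card, map_mk_card]
  exact hθ.sum_pow_length hcomm

end Series

/-! ### Comparing linear coefficients -/

section LinearCoefficient

variable {cs : CoxeterSystem M W} {θ : W ≃* W} {J : Set W}

/-- Lengths add to the maximum when completing to a longest element. -/
theorem length_mul_add_of_forall_le (hJ : J ⊆ gens cs) {x : W} (hx : x ∈ Subgroup.closure J)
    (hmax : ∀ y ∈ Subgroup.closure J, cs.length y ≤ cs.length x) {h : W}
    (hh : h ∈ Subgroup.closure J) : cs.length (x * h) + cs.length h = cs.length x := by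
  refine closure_induction_length_right hJ
    (P := fun h => cs.length (x * h) + cs.length h = cs.length x) (by simp) ?_ hh
  intro h hh k hk hl ih
  have hr : cs.IsReflection (h * k * h⁻¹) := (isReflection_of_mem_gens (hJ hk)).conj h
  have hrJ := mul_mem (mul_mem hh (Subgroup.subset_closure hk)) (inv_mem hh)
  have h1 : cs.length (x * (h * k * h⁻¹)) < cs.length x :=
    lt_of_le_of_ne (hmax _ (mul_mem hx hrJ)) (hr.length_mul_left_ne x)
  have h2 := (length_mul_mul_lt_iff cs (isReflection_of_mem_gens (hJ hk)) x h).2 (by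
    intro h3; have := h3.2 h1; omega)
  have h3 := length_mul_gen (hJ hk) (x * h)
  rw [← mul_assoc]
  omega

theorem eq_of_forall_length_le (hJ : J ⊆ gens cs) {x y : W} (hx : x ∈ Subgroup.closure J)
    (hmax : ∀ y ∈ Subgroup.closure J, cs.length y ≤ cs.length x)
    (hy : y ∈ Subgroup.closure J) (hxy : cs.length x ≤ cs.length y) : y = x := by
  have h1 := length_mul_add_of_forall_le hJ hx hmax (mul_mem (inv_mem hx) hy)
  rw [mul_inv_cancel_left] at h1
  have h2 : cs.length (x⁻¹ * y) = 0 := by omega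
  rw [cs.length_eq_zero_iff, inv_mul_eq_one] at h2
  exact h2.symm

namespace IsDiagramInvolution

variable (hθ : IsDiagramInvolution cs θ)
include hθ

theorem pair_subset {s : W} (hs : s ∈ gens cs) : ({s, θ s} : Set W) ⊆ gens cs :=
  Set.insert_subset hs (Set.singleton_subset_iff.2 (hθ.map_gens s hs))

theorem exists_canonicalGen [Finite W] {s : W} (hs : s ∈ gens cs) :
    ∃ x, (θ x = x ∧ fixLength cs θ x = 1) ∧
      ∀ t ∈ gens cs, cs.length (x * t) < cs.length x ↔ t = s ∨ t = θ s := by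
  have hJ := hθ.pair_subset hs
  obtain ⟨⟨x, hx⟩, hmax⟩ := Finite.exists_max
    fun y : Subgroup.closure ({s, θ s} : Set W) => cs.length (y : W)
  replace hmax : ∀ y ∈ Subgroup.closure ({s, θ s} : Set W), cs.length y ≤ cs.length x :=
    fun y hy => hmax ⟨y, hy⟩
  have hdesc : ∀ t ∈ gens cs, cs.length (x * t) < cs.length x ↔ t = s ∨ t = θ s := by
    refine fun t ht => ⟨fun h => ?_, fun h => ?_⟩
    · exact mem_of_gen_mem_closure (J := {s, θ s}) hJ ht
        (reflection_mem_closure hJ hx (isReflection_of_mem_gens ht) h)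
    · have h1 := length_mul_add_of_forall_le hJ hx hmax
        (Subgroup.subset_closure (show t ∈ ({s, θ s} : Set W) from h))
      rw [length_gen ht] at h1
      omega
  have hmap : θ x ∈ Subgroup.closure ({s, θ s} : Set W) := by
    have h1 := Subgroup.mem_map_of_mem θ.toMonoidHom hx
    rw [MonoidHom.map_closure] at h1
    refine Subgroup.closure_mono ?_ h1
    rintro _ ⟨y, rfl | rfl, rfl⟩
    · exact Or.inr rfl
    · exact Or.inl (hθ.apply_apply s)
  have hcan : x ∈ canonicalGens cs θ := by
    obtain ⟨i, rfl⟩ := hs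
    exact ⟨i, Set.toFinite _, hx, hmax⟩
  have hne : x ≠ 1 := by
    rintro rfl
    have := (hdesc s hs).2 (Or.inl rfl)
    simp at this
  refine ⟨x, ⟨eq_of_forall_length_le hJ hx hmax hmap (hθ.length_map x).ge, ?_⟩, hdesc⟩
  have h1 : fixLength cs θ x ≤ 1 := Nat.sInf_le ⟨[x], rfl, by simpa using hcan, by simp⟩
  have h2 : fixLength cs θ x ≠ 0 := by
    intro h
    rcases Nat.sInf_eq_zero.1 h with ⟨l, hl, -, hp⟩ | h
    · rw [List.length_eq_zero_iff] at hl
      rw [hl, List.prod_nil] at hp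
      exact hne hp.symm
    · exact Set.eq_empty_iff_forall_notMem.1 h 1 ⟨[x], rfl, by simpa using hcan, by simp⟩
  omega

theorem map_mul_gen_mem {s : W} (hs : s ∈ gens cs) (hne : θ s ≠ s) :
    θ s * s ∈ twistedIdentities θ ∧ twistRank cs θ (θ s * s) = 1 := by
  have h1 : θ s * s ∈ twistedIdentities θ := ⟨s, by rw [gen_inv hs]⟩
  have h2 := hθ.twistRank_eq h1
  rw [length_mul_of_ne (hθ.map_gens s hs) hs hne] at h2
  exact ⟨h1, by omega⟩

theorem eq_or_eq_of_map_mul_eq {s t : W} (hs : s ∈ gens cs) (ht : t ∈ gens cs) (hne : θ t ≠ t)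
    (h : θ s * s = θ t * t) : t = s ∨ t = θ s := by
  have hJ := hθ.pair_subset hs
  refine mem_of_gen_mem_closure (J := {s, θ s}) hJ ht (reflection_mem_closure (h := θ s * s) hJ
    (mul_mem (Subgroup.subset_closure (Or.inr rfl)) (Subgroup.subset_closure (Or.inl rfl)))
    (isReflection_of_mem_gens ht) ?_)
  rw [h, gen_mul_cancel_right ht, length_gen (hθ.map_gens t ht),
    length_mul_of_ne (hθ.map_gens t ht) ht hne]
  norm_num

/-- A simple reflection not commuting with its image makes the linear coefficient of the product
too large. -/
theorem card_lt_of_not_commute [Finite W] {a : W} (ha : a ∈ gens cs) (hne : ¬Commute a (θ a)) :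
    Nat.card {w : W // cs.length w = 1} <
      Nat.card {w : W // w ∈ twistedIdentities θ ∧ twistRank cs θ w = 1} +
        Nat.card {w : W // θ w = w ∧ fixLength cs θ w = 1} := by
  obtain ⟨n, ⟨e⟩⟩ := Finite.exists_equiv_fin W
  wlog hlt : e a < e (θ a) generalizing a
  · have h1 : θ a ≠ a := fun h => hne (by rw [h])
    refine this (hθ.map_gens a ha) (fun h => hne ?_) ?_
    · rw [hθ.apply_apply] at h; exact h.symm
    · rw [hθ.apply_apply]
      exact lt_of_le_of_ne (not_lt.1 hlt) fun h => h1 (e.injective h)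
  have hgen : ∀ s : {w : W // cs.length w = 1}, (s : W) ∈ gens cs := fun s => by
    obtain ⟨i, hi⟩ := cs.length_eq_one_iff.1 s.2
    exact ⟨i, hi.symm⟩
  have hgt : ∀ s : W, e (θ s) < e s → θ s ≠ s := fun s h h' => by rw [h'] at h; exact h.false
  choose c hc hcd using fun s : {w : W // cs.length w = 1} => hθ.exists_canonicalGen (hgen s)
  let f : Option {w : W // cs.length w = 1} →
      {w : W // w ∈ twistedIdentities θ ∧ twistRank cs θ w = 1} ⊕
        {w : W // θ w = w ∧ fixLength cs θ w = 1} := fun o => o.elim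
    (Sum.inl ⟨θ a * a, hθ.map_mul_gen_mem ha (fun h => by rw [h] at hlt; exact hlt.false)⟩)
    fun s => if h : e (θ s) < e s then
      Sum.inl ⟨θ s * s, hθ.map_mul_gen_mem (hgen s) (hgt s h)⟩ else Sum.inr ⟨c s, hc s⟩
  have hnone : ∀ s, f none ≠ f (some s) := by
    intro s h
    by_cases hs : e (θ s) < e (s : W)
    · simp only [f, Option.elim_none, Option.elim_some, dif_pos hs, Sum.inl.injEq,
        Subtype.mk.injEq] at h
      rcases hθ.eq_or_eq_of_map_mul_eq ha (hgen s) (hgt s hs) h with h1 | h1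
      · rw [h1] at hs; exact hs.asymm hlt
      · rw [h1, hθ.apply_apply] at h
        exact hne h.symm
    · simp [f, hs] at h
  have hf : Function.Injective f := by
    rintro (_ | s) (_ | t) h
    · rfl
    · exact absurd h (hnone t)
    · exact absurd h.symm (hnone s)
    · have key : (t : W) = s ∨ (t : W) = θ s ∧ (e (θ s) < e (s : W) ↔ e (θ t) < e (t : W)) →
          some s = some t := by
        rintro (h1 | ⟨h1, h2⟩)
        · rw [Subtype.ext h1]
        · have h3 : (t : W) = s := by
            rw [h1, hθ.apply_apply] at h2
            rw [h1]
            apply e.injective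
            rcases lt_trichotomy (e (θ s)) (e (s : W)) with h4 | h4 | h4
            · exact absurd h4 (h2.1 h4).asymm
            · exact h4
            · exact absurd h4 (h2.2 h4).asymm
          rw [Subtype.ext h3]
      apply key
      by_cases hs : e (θ s) < e (s : W) <;> by_cases ht : e (θ t) < e (t : W)
      · simp only [f, Option.elim_some, dif_pos hs, dif_pos ht, Sum.inl.injEq,
          Subtype.mk.injEq] at h
        exact (hθ.eq_or_eq_of_map_mul_eq (hgen s) (hgen t) (hgt t ht) h).imp_right
          fun h => ⟨h, iff_of_true hs ht⟩
      · simp [f, hs, ht] at h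
      · simp [f, hs, ht] at h
      · simp only [f, Option.elim_some, dif_neg hs, dif_neg ht, Sum.inr.injEq,
          Subtype.mk.injEq] at h
        have h1 := (hcd t t (hgen t)).2 (Or.inl rfl)
        rw [← h, hcd s t (hgen t)] at h1
        exact h1.imp_right fun h => ⟨h, iff_of_false hs ht⟩
  have h1 := Nat.card_le_card_of_injective f hf
  rw [Finite.card_option, Nat.card_sum] at h1
  omega

theorem commute_of_poinW_eq [Finite W] (h : poinW cs = poinIota cs θ * poinFix cs θ) :
    ∀ s ∈ gens cs, Commute s (θ s) := by
  intro a ha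
  by_contra hne
  have h1 := hθ.card_lt_of_not_commute ha hne
  have h2 := congrArg (PowerSeries.coeff 1) h
  have h3 : (1 : W) ∈ twistedIdentities θ := ⟨1, by simp⟩
  have h4 : 0 < Nat.card {w : W // w ∈ twistedIdentities θ ∧ twistRank cs θ w = 0} := by
    have := hθ.twistRank_eq h3
    rw [cs.length_one] at this
    have : Nonempty {w : W // w ∈ twistedIdentities θ ∧ twistRank cs θ w = 0} :=
      ⟨⟨1, h3, by omega⟩⟩
    exact Nat.card_pos
  have h5 : 0 < Nat.card {w : W // θ w = w ∧ fixLength cs θ w = 0} := by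
    have : Nonempty {w : W // θ w = w ∧ fixLength cs θ w = 0} := ⟨⟨1, map_one θ, fixLength_one⟩⟩
    exact Nat.card_pos
  rw [PowerSeries.coeff_mul, Finset.Nat.sum_antidiagonal_eq_sum_range_succ_mk,
    Finset.sum_range_succ, Finset.sum_range_one] at h2
  simp only [poinW, poinIota, poinFix, PowerSeries.coeff_mk, Nat.sub_zero, Nat.sub_self] at h2
  have h6 := Nat.le_mul_of_pos_left
    (Nat.card {w : W // θ w = w ∧ fixLength cs θ w = 1}) h4
  have h7 := Nat.le_mul_of_pos_right
    (Nat.card {w : W // w ∈ twistedIdentities θ ∧ twistRank cs θ w = 1}) h5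
  omega

end IsDiagramInvolution

end LinearCoefficient

theorem statement17 [Finite B] [Finite W] (cs : CoxeterSystem M W) (θ : W ≃* W)
    (hθ : Function.Involutive θ)
    (hθS : ∀ i : B, ∃ j : B, θ (cs.simple i) = cs.simple j) :
    poinW cs = poinIota cs θ * poinFix cs θ ↔
      ∀ i : B, Commute (cs.simple i) (θ (cs.simple i)) := by
  have hθ' : IsDiagramInvolution cs θ := by
    refine ⟨hθ, ?_⟩
    rintro _ ⟨i, rfl⟩
    obtain ⟨j, hj⟩ := hθS i
    exact ⟨j, hj.symm⟩
  refine ⟨fun h i => hθ'.commute_of_poinW_eq h _ ⟨i, rfl⟩, fun h => hθ'.poinW_eq ?_⟩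
  rintro _ ⟨i, rfl⟩
  exact h i

end TwistedIdentitiesPaper
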